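/- arXiv:1310.3388 — 13 statements merged into one kernel-verified Lean document; each statement's English description precedes it below -/
import Mathlib

section
/- Let c' ∈ ℝ², r' > 0, and p ∈ ℝ². If there exists a point t ∈ T(c',r') with t.y = p.y and 0 ≤ t.x − p.x ≤ r', then ‖p − c'‖ ≤ r', i.e., p lies in the disk d(c',r'). (Every point within horizontal rightward distance r' of the right portion T(c',r') lies in the disk itself: the region L_{d'} is contained in d'.) -/
open Real

/-- The Euclidean norm of a point of the plane `ℝ × ℝ`. -/
noncomputable def ptNorm (p : ℝ × ℝ) : ℝ := Real.sqrt (p.1 ^ 2 + p.2 ^ 2)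

/-- The parametrization of the right arc: `γ c r θ = c + r·(cos θ, sin θ)`. -/
noncomputable def gam (c : ℝ × ℝ) (r θ : ℝ) : ℝ × ℝ :=
  (c.1 + r * Real.cos θ, c.2 + r * Real.sin θ)

/-- The right portion `T(c,r)`: the closed circular sector
`{c + ρ·(cos θ, sin θ) : 0 ≤ ρ ≤ r, −π/3 ≤ θ ≤ π/3}`. -/
def Sector (c : ℝ × ℝ) (r : ℝ) : Set (ℝ × ℝ) :=
  {p | ∃ ρ θ : ℝ, 0 ≤ ρ ∧ ρ ≤ r ∧ -(π / 3) ≤ θ ∧ θ ≤ π / 3 ∧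
    p = (c.1 + ρ * Real.cos θ, c.2 + ρ * Real.sin θ)}

/-- The right arc `A(c,r)`: the image of `γ c r` on `[−π/3, π/3]`. -/
def Arc (c : ℝ × ℝ) (r : ℝ) : Set (ℝ × ℝ) :=
  {p | ∃ θ : ℝ, -(π / 3) ≤ θ ∧ θ ≤ π / 3 ∧ p = gam c r θ}

/-- General position of two centers: `c' − c` is not a scalar multiple of
`(cos(π/3), sin(π/3))` nor of `(cos(π/3), −sin(π/3))`. -/
def GenPos (c c' : ℝ × ℝ) : Prop :=
  (∀ t : ℝ, c' - c ≠ t • ((Real.cos (π / 3), Real.sin (π / 3)) : ℝ × ℝ)) ∧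
  (∀ t : ℝ, c' - c ≠ t • ((Real.cos (π / 3), -Real.sin (π / 3)) : ℝ × ℝ))

/-- Every point within horizontal rightward distance `r'` of the right
portion `T(c',r')` lies in the disk `d(c',r')` itself (`L_{d'} ⊆ d'`). -/
theorem region_L_subset_disk (c' : ℝ × ℝ) (r' : ℝ) (hr' : 0 < r') (p : ℝ × ℝ)
    (h : ∃ t ∈ Sector c' r', t.2 = p.2 ∧ 0 ≤ t.1 - p.1 ∧ t.1 - p.1 ≤ r') :
    ptNorm (p - c') ≤ r' := by
  obtain ⟨t, ⟨ρ, θ, h0, h1, h2, h3, rfl⟩, hy, hx0, hx1⟩ := h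
  have hC : 1 / 2 ≤ Real.cos θ := by
    rw [← Real.cos_pi_div_three, ← Real.cos_abs θ]
    apply Real.cos_le_cos_of_nonneg_of_le_pi (abs_nonneg θ)
    · linarith [Real.pi_pos]
    · exact abs_le.mpr ⟨h2, h3⟩
  obtain ⟨a, b⟩ := p
  simp only at hy hx0 hx1
  unfold ptNorm
  apply Real.sqrt_le_iff.mpr
  refine ⟨hr'.le, ?_⟩
  simp only [Prod.fst_sub, Prod.snd_sub]
  obtain ⟨s, hs⟩ : ∃ s, s = c'.1 + ρ * Real.cos θ - a := ⟨_, rfl⟩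
  rw [← hs] at hx0 hx1
  have e1 : a - c'.1 = ρ * Real.cos θ - s := by linarith
  have e2 : b - c'.2 = ρ * Real.sin θ := by linarith
  rw [e1, e2]
  have e3 : (ρ * Real.cos θ - s) ^ 2 + (ρ * Real.sin θ) ^ 2
      = ρ ^ 2 - 2 * (ρ * s) * Real.cos θ + s ^ 2 := by
    linear_combination ρ ^ 2 * Real.sin_sq_add_cos_sq θ
  rw [e3]
  have h5 : ρ * s * (1 / 2) ≤ ρ * s * Real.cos θ :=
    mul_le_mul_of_nonneg_left hC (mul_nonneg h0 hx0)
  rcases le_total s ρ with h | h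
  · nlinarith [mul_nonneg hx0 (sub_nonneg.mpr h)]
  · nlinarith [mul_nonneg h0 (sub_nonneg.mpr h)]
end

section
/- Let c' ∈ ℝ², r' > 0, and p ∈ ℝ². If there exists a point t ∈ A(c',r') with t.y = p.y and 0 ≤ t.x − p.x ≤ r', then ‖p − c'‖ ≤ r', i.e., p lies in the disk d(c',r'). (Every point within horizontal rightward distance r' of the right arc A(c',r') lies in the disk itself: the region K_{d'} is contained in d'.) -/
open Real

/-- Every point within horizontal rightward distance `r'` of the right
arc `A(c',r')` lies in the disk `d(c',r')` itself (`K_{d'} ⊆ d'`). -/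
theorem region_K_subset_disk (c' : ℝ × ℝ) (r' : ℝ) (hr' : 0 < r') (p : ℝ × ℝ)
    (h : ∃ t ∈ Arc c' r', t.2 = p.2 ∧ 0 ≤ t.1 - p.1 ∧ t.1 - p.1 ≤ r') :
    ptNorm (p - c') ≤ r' := by
  obtain ⟨t, ⟨θ, h1, h2, rfl⟩, hy, h0, hle⟩ := h
  have hc : (1 / 2 : ℝ) ≤ Real.cos θ := by
    rw [← Real.cos_pi_div_three, ← Real.cos_abs θ]
    exact Real.cos_le_cos_of_nonneg_of_le_pi (abs_nonneg θ)
      (by linarith [Real.pi_pos]) (abs_le.mpr ⟨h1, h2⟩)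
  simp only [gam] at hy h0 hle
  unfold ptNorm
  apply Real.sqrt_le_iff.mpr
  refine ⟨hr'.le, ?_⟩
  simp only [Prod.fst_sub, Prod.snd_sub]
  rw [← hy]
  obtain ⟨s, hs⟩ : ∃ s, s = c'.1 + r' * Real.cos θ - p.1 := ⟨_, rfl⟩
  rw [← hs] at h0 hle
  have hp : p.1 - c'.1 = r' * Real.cos θ - s := by rw [hs]; ring
  rw [hp]
  have h3 : s ≤ 2 * (r' * Real.cos θ) := by nlinarith
  have h4 := mul_nonneg h0 (sub_nonneg.mpr h3)
  have h5 : r' ^ 2 * (Real.sin θ ^ 2 + Real.cos θ ^ 2) = r' ^ 2 := by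
    rw [Real.sin_sq_add_cos_sq, mul_one]
  nlinarith
end

section
/- Let c ∈ ℝ², r > 0, and let α be an angle with π/3 < α ≤ π. Define the larger sector T_α(c,r) = {c + ρ·(cos θ, sin θ) : 0 ≤ ρ ≤ r, −α ≤ θ ≤ α}. Then there exist points p ∈ ℝ² and t ∈ T_α(c,r) with t.y = p.y and 0 ≤ t.x − p.x ≤ r, yet ‖p − c‖ > r. (The containment property of the previous statements fails as soon as the sector spans more than one third of the disk.) -/
open Real

/-- The sector of half-angle `α`: `{c + ρ·(cos θ, sin θ) : 0 ≤ ρ ≤ r, −α ≤ θ ≤ α}`. -/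
def SectorAngle (c : ℝ × ℝ) (r α : ℝ) : Set (ℝ × ℝ) :=
  {p | ∃ ρ θ : ℝ, 0 ≤ ρ ∧ ρ ≤ r ∧ -α ≤ θ ∧ θ ≤ α ∧
    p = (c.1 + ρ * Real.cos θ, c.2 + ρ * Real.sin θ)}

/-- For any sector of half-angle `α` with `π/3 < α ≤ π`, the containment
property fails: there are points `p` and `t ∈ T_α(c,r)` with `t.y = p.y` and
`0 ≤ t.x − p.x ≤ r`, yet `p` lies outside the disk `d(c,r)`. -/
theorem containment_fails_for_larger_sector (c : ℝ × ℝ) (r α : ℝ)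
    (hr : 0 < r) (hα₁ : π / 3 < α) (hα₂ : α ≤ π) :
    ∃ p t : ℝ × ℝ, t ∈ SectorAngle c r α ∧ t.2 = p.2 ∧
      0 ≤ t.1 - p.1 ∧ t.1 - p.1 ≤ r ∧ r < ptNorm (p - c) := by
  have hpi := Real.pi_pos
  have hcos : Real.cos α < 1 / 2 := by
    rw [← Real.cos_pi_div_three]
    exact Real.cos_lt_cos_of_nonneg_of_le_pi (by linarith) hα₂ hα₁
  refine ⟨(c.1 + r * Real.cos α - r, c.2 + r * Real.sin α),
    (c.1 + r * Real.cos α, c.2 + r * Real.sin α),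
    ⟨r, α, hr.le, le_refl r, by linarith, le_refl α, rfl⟩, rfl, ?_, ?_, ?_⟩
  · simp only
    linarith
  · simp only
    linarith
  · unfold ptNorm
    apply Real.lt_sqrt_of_sq_lt
    simp only [Prod.fst_sub, Prod.snd_sub]
    have h1 := Real.sin_sq_add_cos_sq α
    have h2 : (c.1 + r * Real.cos α - r - c.1) ^ 2 + (c.2 + r * Real.sin α - c.2) ^ 2
        = r ^ 2 + r ^ 2 * (1 - 2 * Real.cos α) := by
      linear_combination r ^ 2 * h1
    rw [h2]
    have h3 : 0 < r ^ 2 * (1 - 2 * Real.cos α) := mul_pos (pow_pos hr 2) (by linarith)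
    linarith
end

section
/- Let 0 < r < r', c, c' ∈ ℝ², and let q ∈ T(c,r) with ‖q − c'‖ > r'. Let I be the unique point of A(c,r) with I.y = q.y and I.x ≥ q.x. Then every point p ∈ A(c',r') with p.y = q.y and p.x ≥ q.x satisfies p.x > I.x. (The rightward horizontal ray from q hits the right arc of the smaller disk strictly before it can hit the right arc of the larger disk.) -/
open Real

/-- If `q ∈ T(c,r)` lies outside the larger disk `d(c',r')`, then the
rightward horizontal ray from `q` hits the right arc `A(c,r)` of the smaller disk
strictly before any point of the right arc `A(c',r')` of the larger disk. -/
theorem small_arc_hit_before_large_arc (c c' : ℝ × ℝ) (r r' : ℝ)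
    (hr : 0 < r) (hrr' : r < r')
    (q : ℝ × ℝ) (hq : q ∈ Sector c r) (hq' : r' < ptNorm (q - c'))
    (I : ℝ × ℝ) (hI : I ∈ Arc c r) (hIy : I.2 = q.2) (hIx : q.1 ≤ I.1) :
    ∀ p ∈ Arc c' r', p.2 = q.2 → q.1 ≤ p.1 → I.1 < p.1 := by
  rintro p ⟨φ, h1, h2, rfl⟩ hpy hpx
  obtain ⟨ρ, θ, hρ, hρr, h3, h4, rfl⟩ := hq
  obtain ⟨α, h5, h6, rfl⟩ := hI
  simp only [gam, ptNorm, Prod.fst_sub, Prod.snd_sub] at *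
  have hpi := Real.pi_pos
  have hφ : 1 / 2 ≤ Real.cos φ := by
    rw [← Real.cos_abs, ← Real.cos_pi_div_three]
    exact Real.cos_le_cos_of_nonneg_of_le_pi (abs_nonneg _) (by linarith)
      (abs_le.mpr ⟨h1, h2⟩)
  have hθ : 0 ≤ Real.cos θ :=
    Real.cos_nonneg_of_mem_Icc ⟨by linarith, by linarith⟩
  have hx : 0 ≤ ρ * Real.cos θ := mul_nonneg hρ hθ
  have hα : r * Real.cos α ≤ r := by nlinarith [Real.cos_le_one α]
  have hk : r' / 2 ≤ r' * Real.cos φ := by nlinarith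
  have hsq := (Real.lt_sqrt (by linarith)).mp hq'
  have e : c.2 + ρ * Real.sin θ - c'.2 = r' * Real.sin φ := by linarith
  rw [e] at hsq
  have hc := Real.sin_sq_add_cos_sq φ
  have hd : (r' * Real.cos φ) ^ 2 < (c.1 + ρ * Real.cos θ - c'.1) ^ 2 := by
    have : r' ^ 2 = (r' * Real.sin φ) ^ 2 + (r' * Real.cos φ) ^ 2 := by
      linear_combination (-r' ^ 2) * hc
    linarith
  have hlt : c.1 + ρ * Real.cos θ - c'.1 < -(r' * Real.cos φ) := by
    by_contra hcon
    have := sq_le_sq' (not_lt.mp hcon)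
      (by linarith : c.1 + ρ * Real.cos θ - c'.1 ≤ r' * Real.cos φ)
    linarith
  linarith
end

section
/- Let 0 < r < r', c, c' ∈ ℝ², and let q ∈ T(c,r) with ‖q − c'‖ > r'. Let I be the unique point of A(c,r) with I.y = q.y and I.x ≥ q.x. Then I ∉ T(c',r'). (The point where the rightward horizontal ray from q hits the right arc of the smaller disk does not lie in the right portion of the larger disk.) -/
open Real

theorem half_le_cos_aux (θ : ℝ) (h1 : -(π / 3) ≤ θ) (h2 : θ ≤ π / 3) :
    1 / 2 ≤ Real.cos θ := by
  rw [← Real.cos_pi_div_three, ← Real.cos_abs θ]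
  exact Real.cos_le_cos_of_nonneg_of_le_pi (abs_nonneg _) (by linarith [Real.pi_pos])
    (abs_le.mpr ⟨h1, h2⟩)

/-- If `q ∈ T(c,r)` lies outside the larger disk `d(c',r')`, then the
point `I` where the rightward horizontal ray from `q` hits the right arc `A(c,r)`
does not lie in the right portion `T(c',r')` of the larger disk. -/
theorem hit_point_not_in_large_sector (c c' : ℝ × ℝ) (r r' : ℝ)
    (hr : 0 < r) (hrr' : r < r')
    (q : ℝ × ℝ) (hq : q ∈ Sector c r) (hq' : r' < ptNorm (q - c'))
    (I : ℝ × ℝ) (hI : I ∈ Arc c r) (hIy : I.2 = q.2) (hIx : q.1 ≤ I.1) :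
    I ∉ Sector c' r' := by
  rintro ⟨ρ, θ, h0, h1, h2, h3, rfl⟩
  obtain ⟨σ, φ, g0, g1, g2, g3, rfl⟩ := hq
  obtain ⟨ψ, k2, k3, hk⟩ := hI
  have hc := half_le_cos_aux θ h2 h3
  have hd := half_le_cos_aux φ g2 g3
  have hs := Real.sin_sq_add_cos_sq θ
  simp only [gam, Prod.mk.injEq] at hk hIy hIx
  obtain ⟨hk1, hk2⟩ := hk
  obtain ⟨t, ht⟩ : ∃ t, t = r * Real.cos ψ - σ * Real.cos φ := ⟨_, rfl⟩
  have ht0 : 0 ≤ t := by linarith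
  have htr : t ≤ r := by nlinarith [Real.cos_le_one ψ, mul_nonneg g0 (by linarith : 0 ≤ Real.cos φ)]
  unfold ptNorm at hq'
  rw [Real.lt_sqrt (by linarith)] at hq'
  have e1 : c.1 + σ * Real.cos φ - c'.1 = ρ * Real.cos θ - t := by linarith
  have e2 : c.2 + σ * Real.sin φ - c'.2 = ρ * Real.sin θ := by linarith
  simp only [Prod.fst_sub, Prod.snd_sub] at hq'
  rw [e1, e2] at hq'
  have e3 : (ρ * Real.cos θ - t) ^ 2 + (ρ * Real.sin θ) ^ 2
      = ρ ^ 2 - 2 * (ρ * t) * Real.cos θ + t ^ 2 := by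
    linear_combination ρ ^ 2 * hs
  rw [e3] at hq'
  have hρt := mul_nonneg h0 ht0
  have e4 : r' ^ 2 < ρ ^ 2 - ρ * t + t ^ 2 := by nlinarith
  rcases le_total ρ t with h | h <;> nlinarith
end

section
/- Let 0 < r < r', c, c' ∈ ℝ² with c'.y > c.y and with c, c' in general position. Let q ∈ T(c,r) with ‖q − c'‖ > r', and let θ_I ∈ [−π/3, π/3] be the unique angle with (γ_{c,r}(θ_I)).y = q.y. Then γ_{c,r}(θ_I) ∉ T(c',r'), and for all θ₁, θ₂ ∈ [−π/3, π/3] with θ₁ < θ₂ ≤ θ_I, if γ_{c,r}(θ₂) ∈ T(c',r') then γ_{c,r}(θ₁) ∈ T(c',r'). That is, θ_I lies in the lowest connected component of the set {θ ∈ [−π/3, π/3] : γ_{c,r}(θ) ∉ T(c',r')}. -/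
open Real

lemma trig_wedge {θ : ℝ} (h1 : -(π / 3) ≤ θ) (h2 : θ ≤ π / 3) :
    Real.sin θ ≤ √3 * Real.cos θ ∧ -Real.sin θ ≤ √3 * Real.cos θ ∧ 1 / 2 ≤ Real.cos θ := by
  have hp := Real.pi_pos
  have a1 : 0 ≤ Real.sin (π / 3 - θ) :=
    Real.sin_nonneg_of_nonneg_of_le_pi (by linarith) (by linarith)
  have a2 : 0 ≤ Real.sin (π / 3 + θ) :=
    Real.sin_nonneg_of_nonneg_of_le_pi (by linarith) (by linarith)
  rw [Real.sin_sub, Real.sin_pi_div_three, Real.cos_pi_div_three] at a1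
  rw [Real.sin_add, Real.sin_pi_div_three, Real.cos_pi_div_three] at a2
  refine ⟨by linarith, by linarith, ?_⟩
  rw [← Real.cos_pi_div_three, ← Real.cos_abs θ]
  exact Real.cos_le_cos_of_nonneg_of_le_pi (abs_nonneg _) (by linarith) (abs_le.2 ⟨h1, h2⟩)

lemma sector_fwd {c p : ℝ × ℝ} {R : ℝ} (h : p ∈ Sector c R) :
    p.2 - c.2 ≤ √3 * (p.1 - c.1) ∧ -(p.2 - c.2) ≤ √3 * (p.1 - c.1) ∧
    (p.1 - c.1) ^ 2 + (p.2 - c.2) ^ 2 ≤ R ^ 2 := by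
  obtain ⟨ρ, θ, h0, hR, h1, h2, rfl⟩ := h
  obtain ⟨a1, a2, -⟩ := trig_wedge h1 h2
  simp only [add_sub_cancel_left]
  refine ⟨by nlinarith, by nlinarith, ?_⟩
  have := Real.sin_sq_add_cos_sq θ
  have e : (ρ * Real.cos θ) ^ 2 + (ρ * Real.sin θ) ^ 2 = ρ ^ 2 := by
    linear_combination ρ ^ 2 * this
  rw [e]
  exact pow_le_pow_left₀ h0 hR 2

lemma sector_bwd {c p : ℝ × ℝ} {R : ℝ} (hR : 0 ≤ R)
    (h1 : p.2 - c.2 ≤ √3 * (p.1 - c.1)) (h2 : -(p.2 - c.2) ≤ √3 * (p.1 - c.1))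
    (h3 : (p.1 - c.1) ^ 2 + (p.2 - c.2) ^ 2 ≤ R ^ 2) : p ∈ Sector c R := by
  have hp := Real.pi_pos
  have hk : 0 < √3 := by positivity
  obtain ⟨x, hx⟩ : ∃ x, x = p.1 - c.1 := ⟨_, rfl⟩
  obtain ⟨y, hy⟩ : ∃ y, y = p.2 - c.2 := ⟨_, rfl⟩
  rw [← hx, ← hy] at h3
  rw [← hx, ← hy] at h2
  rw [← hx, ← hy] at h1
  have hx0 : 0 ≤ x := by nlinarith
  rcases hx0.eq_or_lt with h | h
  · subst h
    have hy0 : y = 0 := by linarith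
    refine ⟨0, 0, le_rfl, hR, by linarith, by linarith, Prod.ext ?_ ?_⟩ <;> simp <;> linarith
  · have hs : 0 < √(1 + (y / x) ^ 2) := by positivity
    have ht : Real.arctan √3 = π / 3 := by
      rw [← Real.tan_pi_div_three]
      exact Real.arctan_tan (by linarith) (by linarith)
    have hsq := Real.sq_sqrt (show 0 ≤ 1 + (y / x) ^ 2 by positivity)
    refine ⟨x * √(1 + (y / x) ^ 2), Real.arctan (y / x), by positivity, ?_, ?_, ?_,
      Prod.ext ?_ ?_⟩
    · refine (abs_le_of_sq_le_sq' ?_ hR).2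
      rw [mul_pow, hsq]
      have : x ^ 2 * (1 + (y / x) ^ 2) = x ^ 2 + y ^ 2 := by field_simp
      linarith
    · rw [← ht, ← Real.arctan_neg]
      apply Real.arctan_strictMono.monotone
      rw [le_div_iff₀ h]; linarith
    · rw [← ht]
      apply Real.arctan_strictMono.monotone
      rw [div_le_iff₀ h]; linarith
    · rw [Real.cos_arctan]
      field_simp
      linarith
    · rw [Real.sin_arctan]
      field_simp
      linarith

/-- If the hit point is in the big disk, no point of the big sector at most that high
has abscissa at most `r`. -/
lemma low_far {k r r' a b qx y xI px py : ℝ} (hk : 0 < k) (hk2 : k ^ 2 = 3) (hr : 0 < r)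
    (hrr : r < r') (hb : 0 < b)
    (q1 : y ≤ k * qx) (q2 : -y ≤ k * qx) (q3 : qx ^ 2 + y ^ 2 ≤ r ^ 2)
    (hqI : qx ≤ xI) (hI : (xI - a) ^ 2 + (y - b) ^ 2 ≤ r' ^ 2)
    (hq : r' ^ 2 < (qx - a) ^ 2 + (y - b) ^ 2)
    (t1 : py - b ≤ k * (px - a)) (t2 : -(py - b) ≤ k * (px - a))
    (t3 : (px - a) ^ 2 + (py - b) ^ 2 ≤ r' ^ 2) (hpy : py ≤ y) (hpx : px ≤ r) : False := by
  have hq0 : 0 ≤ qx := (mul_nonneg_iff_of_pos_left hk).1 (by linarith)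
  have hp0 : 0 ≤ px - a := (mul_nonneg_iff_of_pos_left hk).1 (by linarith)
  have hqa : qx < a := by
    by_contra h
    push Not at h
    have := pow_le_pow_left₀ (show 0 ≤ qx - a by linarith) (show qx - a ≤ xI - a by linarith) 2
    linarith
  rcases le_or_gt b y with hyb | hyb
  · have e1 : (a - qx) ^ 2 ≤ (r - qx) ^ 2 := pow_le_pow_left₀ (by linarith) (by linarith) 2
    have e2 : (y - b) ^ 2 ≤ y ^ 2 := pow_le_pow_left₀ (by linarith) (by linarith) 2
    have e3 : r ^ 2 < r' ^ 2 := pow_lt_pow_left₀ hrr hr.le (by norm_num)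
    have e4 : 2 * r * qx < qx ^ 2 + y ^ 2 := by linarith
    have e5 : y ^ 2 ≤ 3 * qx ^ 2 := by
      have h0 : 0 ≤ y := by linarith
      have := pow_le_pow_left₀ h0 q1 2
      rwa [mul_pow, hk2] at this
    have e6 : (2 * r * qx) ^ 2 < (qx ^ 2 + y ^ 2) ^ 2 :=
      pow_lt_pow_left₀ e4 (by positivity) (by norm_num)
    have e7 : (qx ^ 2 + y ^ 2) * (qx ^ 2 + y ^ 2) ≤ r ^ 2 * (4 * qx ^ 2) :=
      mul_le_mul q3 (by linarith) (by positivity) (by positivity)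
    linarith
  · have hd : 0 < b - y := by linarith
    have e1 : k * (a - qx) + (b - y) ≤ k * r' := by
      have := mul_nonneg hk.le (show 0 ≤ r' - px + qx by linarith)
      linarith
    have e2 : (k * (a - qx)) ^ 2 ≤ (k * r' - (b - y)) ^ 2 :=
      pow_le_pow_left₀ (mul_nonneg hk.le (by linarith)) (by linarith) 2
    have e3 : 3 * (b - y) ^ 2 + (k * r' - (b - y)) ^ 2 > 3 * r' ^ 2 := by
      rw [mul_pow, hk2] at e2
      linarith
    have e4 : (b - y) * (2 * k * r') < (b - y) * (4 * (b - y)) := by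
      have : k ^ 2 * r' ^ 2 = 3 * r' ^ 2 := by rw [hk2]
      linarith
    have e5 := lt_of_mul_lt_mul_left e4 hd.le
    have e6 : (b - py) ^ 2 ≤ 3 * (px - a) ^ 2 := by
      have h0 : 0 ≤ -(py - b) := by linarith
      have := pow_le_pow_left₀ h0 t2 2
      rw [mul_pow, hk2] at this
      linarith
    have e7 : (2 * k * r') ^ 2 < (4 * (b - y)) ^ 2 :=
      pow_lt_pow_left₀ e5 (mul_nonneg (by linarith) (by linarith)) (by norm_num)
    have e8 : (b - y) ^ 2 ≤ (b - py) ^ 2 := pow_le_pow_left₀ hd.le (by linarith) 2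
    have : k ^ 2 * r' ^ 2 = 3 * r' ^ 2 := by rw [hk2]
    linarith

/-- Case where the hit point is outside the big disk. -/
lemma arc_case {k r r' a b x1 y1 x2 y2 x3 y3 : ℝ} (hk : 0 < k) (hr : 0 < r)
    (hrr : r < r') (hb : 0 < b)
    (n1 : x1 ^ 2 + y1 ^ 2 = r ^ 2) (n2 : x2 ^ 2 + y2 ^ 2 = r ^ 2) (n3 : x3 ^ 2 + y3 ^ 2 = r ^ 2)
    (g1 : r / 2 ≤ x1) (g2 : r / 2 ≤ x2) (g3 : r / 2 ≤ x3)
    (w1 : y1 ≤ k * x1) (v1 : -y1 ≤ k * x1) (v2 : -y2 ≤ k * x2) (v3 : -y3 ≤ k * x3)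
    (m12 : y1 < y2) (m23 : y2 < y3)
    (o12 : y1 * x2 ≤ y2 * x1) (o13 : y1 * x3 ≤ y3 * x1) (o23 : y2 * x3 ≤ y3 * x2)
    (t1 : y2 - b ≤ k * (x2 - a)) (t2 : -(y2 - b) ≤ k * (x2 - a))
    (t3 : (x2 - a) ^ 2 + (y2 - b) ^ 2 ≤ r' ^ 2)
    (hI : r' ^ 2 < (x3 - a) ^ 2 + (y3 - b) ^ 2) :
    y1 - b ≤ k * (x1 - a) ∧ -(y1 - b) ≤ k * (x1 - a) ∧
      (x1 - a) ^ 2 + (y1 - b) ^ 2 ≤ r' ^ 2 := by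
  have f : a * x3 + b * y3 < a * x2 + b * y2 := by linarith
  have d23 : (x2 - x3) * (x2 + x3) = (y3 - y2) * (y3 + y2) := by linarith
  have d12 : (x1 - x2) * (x1 + x2) = (y2 - y1) * (y2 + y1) := by linarith
  have hX : 0 < x2 + x3 := by linarith
  have hX' : 0 < x1 + x2 := by linarith
  have key : b * (x2 + x3) < a * (y2 + y3) := by
    have h1 : (y3 - y2) * (b * (x2 + x3)) < (y3 - y2) * (a * (y2 + y3)) := by
      have : b * (y3 - y2) * (x2 + x3) < a * (x2 - x3) * (x2 + x3) :=
        mul_lt_mul_of_pos_right (by linarith) hX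
      have e : a * (x2 - x3) * (x2 + x3) = a * ((y3 - y2) * (y3 + y2)) := by rw [← d23]; ring
      linarith
    exact lt_of_mul_lt_mul_left h1 (by linarith)
  have hbX : 0 < b * (x2 + x3) := mul_pos hb hX
  rcases lt_or_ge 0 a with ha | ha
  · exfalso
    have hY : 0 < y2 + y3 := by
      by_contra h
      push Not at h
      have := mul_nonneg ha.le (neg_nonneg.2 h)
      linarith
    have hx : x3 < x2 := by
      by_contra h
      push Not at h
      have := mul_pos (show 0 < y3 - y2 by linarith) hY
      have := mul_nonneg (sub_nonneg.2 h) hX.le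
      linarith
    have ax : a ≤ 2 * x3 := by
      have : x2 ≤ r := (abs_le_of_sq_le_sq' (by linarith [sq_nonneg y2]) hr.le).2
      have : 0 ≤ x2 - a := (mul_nonneg_iff_of_pos_left hk).1 (by linarith)
      linarith
    have h3 : b * x3 < a * y3 := by
      have := mul_pos hb (sub_pos.2 hx)
      have := mul_pos ha (sub_pos.2 m23)
      linarith
    have y3p : 0 < y3 := by linarith
    have b2 : b < 2 * y3 := by
      have : x3 * b < x3 * (2 * y3) := by
        have := mul_nonneg y3p.le (sub_nonneg.2 ax)
        linarith
      exact lt_of_mul_lt_mul_left this (by linarith)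
    have r2 : r ^ 2 < r' ^ 2 := pow_lt_pow_left₀ hrr hr.le (by norm_num)
    have p1 := mul_nonneg ha.le (sub_nonneg.2 ax)
    have p2 := mul_pos hb (sub_pos.2 b2)
    linarith
  · have hbk : b ≤ k * (-a) := by
      have : (x2 + x3) * b ≤ (x2 + x3) * (k * (-a)) := by
        have := mul_nonneg (show 0 ≤ -a by linarith)
          (show 0 ≤ k * (x2 + x3) + (y2 + y3) by linarith)
        linarith
      exact le_of_mul_le_mul_left this hX
    refine ⟨by linarith, by linarith, ?_⟩
    have mono : (y1 + y2) * (x2 + x3) ≤ (y2 + y3) * (x1 + x2) := by linarith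
    have key2 : b * (x1 + x2) ≤ a * (y1 + y2) := by
      have : (x2 + x3) * (b * (x1 + x2)) ≤ (x2 + x3) * (a * (y1 + y2)) := by
        have s1 := mul_le_mul_of_nonneg_right key.le hX'.le
        have s2 := mul_nonneg (show 0 ≤ -a by linarith) (sub_nonneg.2 mono)
        linarith
      exact le_of_mul_le_mul_left this hX
    have fin : a * x2 + b * y2 ≤ a * x1 + b * y1 := by
      have h1 := mul_le_mul_of_nonneg_left key2 (show 0 ≤ y2 - y1 by linarith)
      have e : (x1 + x2) * (a * (x1 - x2)) = a * ((y2 - y1) * (y2 + y1)) := by rw [← d12]; ring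
      have : (x1 + x2) * (b * (y2 - y1)) ≤ (x1 + x2) * (a * (x1 - x2)) := by linarith
      have := le_of_mul_le_mul_left this hX'
      linarith
    linarith

lemma sin_cross {s t : ℝ} (hs : -(π / 3) ≤ s) (ht : t ≤ π / 3) (h : s ≤ t) (r : ℝ) :
    r * Real.sin s * (r * Real.cos t) ≤ r * Real.sin t * (r * Real.cos s) := by
  have hp := Real.pi_pos
  have a1 : 0 ≤ Real.sin (t - s) :=
    Real.sin_nonneg_of_nonneg_of_le_pi (by linarith) (by linarith)
  rw [Real.sin_sub] at a1
  have := mul_nonneg (sq_nonneg r) a1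
  linarith

/-- If the center of the larger disk lies above that of the smaller one,
and `q ∈ T(c,r)` lies outside the larger disk, then the angle `θ_I` of the point
where the rightward ray from `q` hits `A(c,r)` lies in the lowest connected component
of `{θ ∈ [−π/3, π/3] : γ_{c,r}(θ) ∉ T(c',r')}`. -/
theorem hit_angle_in_lowest_component (c c' : ℝ × ℝ) (r r' : ℝ)
    (hr : 0 < r) (hrr' : r < r') (hy : c.2 < c'.2) (hgp : GenPos c c')
    (q : ℝ × ℝ) (hq : q ∈ Sector c r) (hq' : r' < ptNorm (q - c'))
    (θI : ℝ) (hθI : θI ∈ Set.Icc (-(π / 3)) (π / 3)) (hy' : (gam c r θI).2 = q.2) :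
    gam c r θI ∉ Sector c' r' ∧
    ∀ θ₁ θ₂ : ℝ, θ₁ ∈ Set.Icc (-(π / 3)) (π / 3) → θ₂ ∈ Set.Icc (-(π / 3)) (π / 3) →
      θ₁ < θ₂ → θ₂ ≤ θI → gam c r θ₂ ∈ Sector c' r' → gam c r θ₁ ∈ Sector c' r' := by
  obtain ⟨cx, cy⟩ := c
  obtain ⟨a, b⟩ := c'
  obtain ⟨qx, qy⟩ := q
  have hp := Real.pi_pos
  have hk : 0 < √3 := by positivity
  have hk2 : √3 ^ 2 = 3 := Real.sq_sqrt (by norm_num)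
  have hr0 : 0 < r' := hr.trans hrr'
  obtain ⟨q1, q2, q3⟩ := sector_fwd hq
  have hqD : r' ^ 2 < (qx - a) ^ 2 + (qy - b) ^ 2 := by
    have := (Real.lt_sqrt hr0.le).1 hq'
    simpa using this
  have nrm : ∀ θ : ℝ, (r * Real.cos θ) ^ 2 + (r * Real.sin θ) ^ 2 = r ^ 2 := by
    intro θ
    linear_combination r ^ 2 * Real.sin_sq_add_cos_sq θ
  obtain ⟨i1, i2, i3⟩ := trig_wedge hθI.1 hθI.2
  simp only [gam] at hy' q1 q2 q3 hy ⊢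
  have hqI : qx - cx ≤ r * Real.cos θI := by
    have e := nrm θI
    have : qy - cy = r * Real.sin θI := by linarith
    rw [this] at q3
    exact (abs_le_of_sq_le_sq' (by linarith) (mul_nonneg hr.le (by linarith))).2
  have hcos : ∀ θ : ℝ, r * Real.cos θ ≤ r := fun θ => by nlinarith [Real.cos_le_one θ]
  -- no point of the arc at most as high as the hit point is in the big sector
  have L : (cx + r * Real.cos θI - a) ^ 2 + (cy + r * Real.sin θI - b) ^ 2 ≤ r' ^ 2 →
      ∀ θ : ℝ, Real.sin θ ≤ Real.sin θI →
      (cx + r * Real.cos θ, cy + r * Real.sin θ) ∉ Sector (a, b) r' := by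
    intro hD θ hθ hS
    obtain ⟨t1, t2, t3⟩ := sector_fwd hS
    simp only at t1 t2 t3
    refine low_far (a := a - cx) (b := b - cy) (qx := qx - cx) (y := qy - cy)
      (xI := r * Real.cos θI) (px := r * Real.cos θ) (py := r * Real.sin θ)
      hk hk2 hr hrr' (by linarith) q1 q2 q3 hqI ?_ ?_ (by linarith) (by linarith) ?_ ?_ (hcos θ)
    · rw [← hy']; convert hD using 1; ring
    · convert hqD using 1; ring
    · convert t3 using 1; ring
    · have := mul_le_mul_of_nonneg_left hθ hr.le
      linarith
  refine ⟨fun hS => L (sector_fwd hS).2.2 θI le_rfl hS, ?_⟩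
  intro θ₁ θ₂ h1 h2 h12 h2I hS
  by_cases hD : (cx + r * Real.cos θI - a) ^ 2 + (cy + r * Real.sin θI - b) ^ 2 ≤ r' ^ 2
  · refine absurd hS (L hD θ₂ ?_)
    exact Real.sin_le_sin_of_le_of_le_pi_div_two (by linarith [h2.1]) (by linarith [hθI.2]) h2I
  push Not at hD
  obtain ⟨t1, t2, t3⟩ := sector_fwd hS
  simp only at t1 t2 t3
  rcases h2I.eq_or_lt with h | h
  · subst h; linarith
  obtain ⟨u1, v1, w1⟩ := trig_wedge h1.1 h1.2
  obtain ⟨u2, v2, w2⟩ := trig_wedge h2.1 h2.2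
  have M : ∀ {x y : ℝ}, x ≤ y → r * x ≤ r * y := fun h => mul_le_mul_of_nonneg_left h hr.le
  have s12 := Real.sin_lt_sin_of_lt_of_le_pi_div_two (by linarith [h1.1]) (by linarith [h2.2]) h12
  have s2I := Real.sin_lt_sin_of_lt_of_le_pi_div_two (by linarith [h2.1]) (by linarith [hθI.2]) h
  obtain ⟨z1, z2, z3⟩ := arc_case (k := √3) (a := a - cx) (b := b - cy) (r' := r')
    hk hr hrr' (by linarith) (nrm θ₁) (nrm θ₂) (nrm θI)
    (by linarith [M w1]) (by linarith [M w2]) (by linarith [M i3]) (by linarith [M u1])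
    (by linarith [M v1]) (by linarith [M v2]) (by linarith [M i2]) (mul_lt_mul_of_pos_left s12 hr) (mul_lt_mul_of_pos_left s2I hr)
    (sin_cross h1.1 h2.2 h12.le r) (sin_cross h1.1 hθI.2 (h12.trans h).le r)
    (sin_cross h2.1 hθI.2 h.le r) (by linarith) (by linarith)
    (by linarith) (by linarith)
  apply sector_bwd hr0.le
  · simp only; linarith
  · simp only; linarith
  · simp only; convert z3 using 1; ring
end

section
/- Let 0 < r < r' and c, c' ∈ ℝ² with c'.y > c.y. Let θ ∈ (0, π/3]. If γ_{c,r}(θ) ∉ T(c',r'), then also γ_{c,r}(−θ) ∉ T(c',r'). (If a point p on the top half of the right arc A(c,r) lies outside the right portion of a larger disk whose center is above c, then its conjugate point — the second intersection of A(c,r) with the vertical line through p — also lies outside that right portion.) -/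
open Real

/-- Lemma 2 of the paper: if a point on the top half of the right arc
`A(c,r)` lies outside the right portion of a larger disk whose center is above `c`,
then its conjugate point `γ_{c,r}(−θ)` also lies outside that right portion. -/
theorem conjugate_point_outside (c c' : ℝ × ℝ) (r r' : ℝ)
    (hr : 0 < r) (hrr' : r < r') (hy : c.2 < c'.2)
    (θ : ℝ) (hθ₁ : 0 < θ) (hθ₂ : θ ≤ π / 3)
    (h : gam c r θ ∉ Sector c' r') :
    gam c r (-θ) ∉ Sector c' r' := by
  intro hq
  apply h
  obtain ⟨ρ, φ, h0, h1, h2, h3, he⟩ := hq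
  have hpi := Real.pi_pos
  simp only [gam, Real.cos_neg, Real.sin_neg, Prod.mk.injEq] at he
  obtain ⟨hx, hv⟩ := he
  have hs : 0 < r * Real.sin θ :=
    mul_pos hr (Real.sin_pos_of_pos_of_lt_pi hθ₁ (by linarith))
  have hcos : 0 < Real.cos φ := Real.cos_pos_of_mem_Ioo ⟨by linarith, by linarith⟩
  have hρ : 0 < ρ := by
    rcases h0.lt_or_eq with h0 | h0
    · exact h0
    · subst h0
      exfalso
      linarith
  have hu : 0 < ρ * Real.cos φ := mul_pos hρ hcos
  set w : ℝ := c.2 + r * Real.sin θ - c'.2 with hw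
  set u : ℝ := ρ * Real.cos φ with hu'
  have hw1 : w ≤ -(ρ * Real.sin φ) := by linarith
  have hw2 : ρ * Real.sin φ ≤ w := by linarith
  have htan : Real.tan φ = ρ * Real.sin φ / u := by
    rw [Real.tan_eq_sin_div_cos, hu', mul_div_mul_left _ _ hρ.ne']
  have hat : Real.arctan (Real.tan φ) = φ := Real.arctan_tan (by linarith) (by linarith)
  have ha1 : φ ≤ Real.arctan (w / u) := by
    rw [← hat]
    apply Real.arctan_mono
    rw [htan]
    exact div_le_div_of_nonneg_right hw2 hu.le
  have ha2 : Real.arctan (w / u) ≤ -φ := by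
    rw [← hat, ← Real.arctan_neg]
    apply Real.arctan_mono
    rw [htan, ← neg_div]
    exact div_le_div_of_nonneg_right hw1 hu.le
  have hsq : 0 < Real.sqrt (1 + (w / u) ^ 2) := Real.sqrt_pos.mpr (by positivity)
  have hcw : u * Real.sqrt (1 + (w / u) ^ 2) * Real.cos (Real.arctan (w / u)) = u := by
    rw [Real.cos_arctan]
    field_simp
  have hsw : u * Real.sqrt (1 + (w / u) ^ 2) * Real.sin (Real.arctan (w / u)) = w := by
    rw [Real.sin_arctan]
    generalize Real.sqrt (1 + (w / u) ^ 2) = q at hsq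
    field_simp
  refine ⟨u * Real.sqrt (1 + (w / u) ^ 2), Real.arctan (w / u), by positivity, ?_,
    by linarith, by linarith, ?_⟩
  · refine le_trans ?_ h1
    refine abs_le_of_sq_le_sq' ?_ h0 |>.2
    rw [mul_pow, Real.sq_sqrt (by positivity)]
    have e1 : u ^ 2 * (1 + (w / u) ^ 2) = u ^ 2 + w ^ 2 := by field_simp
    have e2 : ρ ^ 2 = u ^ 2 + (ρ * Real.sin φ) ^ 2 := by
      rw [hu']
      linear_combination (-ρ ^ 2) * Real.sin_sq_add_cos_sq φ
    rw [e1, e2]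
    nlinarith
  · rw [hcw, hsw]
    simp only [gam, Prod.mk.injEq]
    exact ⟨hx, by rw [hw]; ring⟩
end

section
/- Let c ∈ ℝ², r > 0, and let (c_i, r_i), i ∈ F, be a finite family with r_i > r and c_i.y > c.y for every i ∈ F. Let θ ∈ (0, π/3]. If γ_{c,r}(θ) ∉ ⋃_{i∈F} T(c_i,r_i), then also γ_{c,r}(−θ) ∉ ⋃_{i∈F} T(c_i,r_i). (If a point on the top half of the right arc A(c,r) lies outside the union of the right portions of a family of larger disks all of whose centers lie above c, then its conjugate point also lies outside that union.) -/
open Real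

lemma sector_aux (ρ R φ y : ℝ) (h0 : 0 < ρ) (hR : ρ ≤ R) (h1 : -(π / 3) ≤ φ) (h2 : φ ≤ π / 3)
    (hy : |y| ≤ -(ρ * Real.sin φ)) :
    ∃ ρ' θ' : ℝ, 0 ≤ ρ' ∧ ρ' ≤ R ∧ -(π / 3) ≤ θ' ∧ θ' ≤ π / 3 ∧
      ρ * Real.cos φ = ρ' * Real.cos θ' ∧ y = ρ' * Real.sin θ' := by
  have hpi := Real.pi_pos
  have hc : 0 < Real.cos φ := Real.cos_pos_of_mem_Ioo ⟨by linarith, by linarith⟩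
  have hx : 0 < ρ * Real.cos φ := mul_pos h0 hc
  have hs : 0 ≤ Real.sin (φ + π / 3) :=
    Real.sin_nonneg_of_nonneg_of_le_pi (by linarith) (by linarith)
  rw [Real.sin_add, Real.cos_pi_div_three, Real.sin_pi_div_three] at hs
  have hs' : -Real.sin φ ≤ √3 * Real.cos φ := by linarith
  have hsr : -(ρ * Real.sin φ) ≤ √3 * (ρ * Real.cos φ) := by
    nlinarith [mul_le_mul_of_nonneg_left hs' h0.le]
  have hyy : y ^ 2 ≤ (ρ * Real.sin φ) ^ 2 := by
    rw [← neg_sq (ρ * Real.sin φ)]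
    exact sq_le_sq' (by linarith [neg_abs_le y]) (by linarith [le_abs_self y])
  have hnorm : (ρ * Real.cos φ) ^ 2 + y ^ 2 ≤ ρ ^ 2 := by
    nlinarith [Real.sin_sq_add_cos_sq φ]
  generalize ρ * Real.cos φ = x at *
  have hz : |y / x| ≤ √3 := by
    rw [abs_div, abs_of_pos hx, div_le_iff₀ hx]
    linarith
  have hat : Real.arctan (√3) = π / 3 := by
    rw [← Real.tan_pi_div_three]
    exact Real.arctan_tan (by linarith) (by linarith)
  have hq : 0 < √(1 + (y / x) ^ 2) := Real.sqrt_pos.mpr (by positivity)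
  refine ⟨x * √(1 + (y / x) ^ 2), Real.arctan (y / x), by positivity, ?_, ?_, ?_, ?_, ?_⟩
  · refine le_trans (abs_le_of_sq_le_sq' ?_ h0.le).2 hR
    rw [mul_pow, Real.sq_sqrt (by positivity)]
    have : x ^ 2 * (1 + (y / x) ^ 2) = x ^ 2 + y ^ 2 := by field_simp
    linarith
  · rw [← hat, ← Real.arctan_neg]
    exact Real.arctan_strictMono.monotone (abs_le.mp hz).1
  · rw [← hat]
    exact Real.arctan_strictMono.monotone (abs_le.mp hz).2
  · rw [Real.cos_arctan]
    field_simp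
  · rw [Real.sin_arctan]
    field_simp

/-- Corollary of Lemma 2: if a point on the top half of the right arc
`A(c,r)` lies outside the union of the right portions of a finite family of larger
disks whose centers all lie above `c`, then its conjugate point also lies outside
that union. -/
theorem conjugate_point_outside_union {ι : Type*} (F : Finset ι)
    (c : ℝ × ℝ) (r : ℝ) (hr : 0 < r)
    (ci : ι → ℝ × ℝ) (ri : ι → ℝ)
    (hri : ∀ i ∈ F, r < ri i) (hyi : ∀ i ∈ F, c.2 < (ci i).2)
    (θ : ℝ) (hθ₁ : 0 < θ) (hθ₂ : θ ≤ π / 3)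
    (h : gam c r θ ∉ ⋃ i ∈ F, Sector (ci i) (ri i)) :
    gam c r (-θ) ∉ ⋃ i ∈ F, Sector (ci i) (ri i) := by
  intro hmem
  apply h
  simp only [Set.mem_iUnion] at hmem ⊢
  obtain ⟨i, hi, ρ, φ, h0, hR, h1, h2, he⟩ := hmem
  refine ⟨i, hi, ?_⟩
  have hy := hyi i hi
  simp only [gam, Real.cos_neg, Real.sin_neg, Prod.mk.injEq] at he
  obtain ⟨e1, e2⟩ := he
  have hs : 0 < r * Real.sin θ :=
    mul_pos hr (Real.sin_pos_of_pos_of_lt_pi hθ₁ (by linarith [Real.pi_pos]))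
  have hρ : 0 < ρ := by
    rcases h0.lt_or_eq with h' | h'
    · exact h'
    · subst h'
      nlinarith
  obtain ⟨ρ', θ', a, b, c1, d, e, f⟩ := sector_aux ρ (ri i) φ
    (c.2 + r * Real.sin θ - (ci i).2) hρ hR h1 h2 (by
      rw [abs_le]
      constructor <;> linarith)
  refine ⟨ρ', θ', a, b, c1, d, ?_⟩
  simp only [gam, Prod.mk.injEq]
  constructor <;> linarith
end

section
/- Let 0 < r < r', c, c' ∈ ℝ² with c'.y > c.y and with c, c' in general position. Suppose A(c,r) \ T(c',r') is disconnected, i.e., there exist −π/3 ≤ θ₁ < θ₂ < θ₃ ≤ π/3 with γ_{c,r}(θ₁) ∉ T(c',r'), γ_{c,r}(θ₂) ∈ T(c',r'), and γ_{c,r}(θ₃) ∉ T(c',r'). Then there exists θ > 0 with γ_{c,r}(θ) ∈ T(c',r'); equivalently, the topmost intersection point of the right arc A(c,r) with the boundary of T(c',r') lies strictly above the horizontal line through the center c. -/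
open Real

lemma aux_cos_half {θ : ℝ} (h1 : -(π / 3) ≤ θ) (h2 : θ ≤ π / 3) : 1 / 2 ≤ Real.cos θ := by
  rw [← Real.cos_abs, ← Real.cos_pi_div_three]
  have := Real.pi_pos
  exact Real.cos_le_cos_of_nonneg_of_le_pi (abs_nonneg _) (by linarith) (abs_le.2 ⟨h1, h2⟩)

lemma aux_mem_fwd {c p : ℝ × ℝ} {r : ℝ} (h : p ∈ Sector c r) :
    |p.2 - c.2| ≤ √3 * (p.1 - c.1) ∧ (p.1 - c.1) ^ 2 + (p.2 - c.2) ^ 2 ≤ r ^ 2 := by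
  obtain ⟨ρ, θ, h0, hr, h1, h2, rfl⟩ := h
  have hc := aux_cos_half h1 h2
  have hsc := Real.sin_sq_add_cos_sq θ
  have h3 : √3 ^ 2 = 3 := Real.sq_sqrt (by norm_num)
  have h3' : 0 ≤ √3 := Real.sqrt_nonneg _
  constructor
  · simp only [add_sub_cancel_left]
    rw [abs_mul, abs_of_nonneg h0]
    have : |Real.sin θ| ≤ √3 * Real.cos θ := by
      apply abs_le_of_sq_le_sq _ (by positivity)
      rw [mul_pow, h3]; nlinarith
    nlinarith
  · simp only [add_sub_cancel_left]
    have : (ρ * Real.cos θ) ^ 2 + (ρ * Real.sin θ) ^ 2 = ρ ^ 2 := by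
      linear_combination ρ ^ 2 * hsc
    rw [this]
    exact pow_le_pow_left₀ h0 hr 2

lemma aux_mem_bwd {c p : ℝ × ℝ} {r : ℝ} (hr : 0 ≤ r)
    (h : |p.2 - c.2| ≤ √3 * (p.1 - c.1)) (hd : (p.1 - c.1) ^ 2 + (p.2 - c.2) ^ 2 ≤ r ^ 2) :
    p ∈ Sector c r := by
  obtain ⟨x, y⟩ := p
  obtain ⟨a, b⟩ := c
  simp only at h hd
  have h3' : 0 < √3 := by positivity
  have hu : 0 ≤ x - a := by
    have := (abs_nonneg _).trans h
    exact nonneg_of_mul_nonneg_right this h3'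
  rcases hu.eq_or_lt with hu | hu
  · rw [← hu] at h
    have hv : y - b = 0 := by
      apply abs_nonpos_iff.1; simpa using h
    refine ⟨0, 0, le_rfl, hr, ?_, ?_, ?_⟩
    · have := Real.pi_pos
      linarith
    · positivity
    · ext <;> simp <;> linarith
  · set t := (y - b) / (x - a) with ht
    have hv : y - b = t * (x - a) := by rw [ht]; field_simp
    have habs : |t| ≤ √3 := by
      rw [ht, abs_div, abs_of_pos hu]
      exact (div_le_iff₀ hu).2 h
    have hat : Real.arctan √3 = π / 3 := Real.arctan_sqrt_three
    have hs : 0 < √(1 + t ^ 2) := by positivity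
    have hs2 : √(1 + t ^ 2) ^ 2 = 1 + t ^ 2 := Real.sq_sqrt (by positivity)
    refine ⟨(x - a) * √(1 + t ^ 2), Real.arctan t, by positivity, ?_, ?_, ?_, ?_⟩
    · apply le_of_sq_le_sq _ hr
      rw [mul_pow, hs2]
      rw [hv] at hd
      linarith
    · rw [← hat, ← Real.arctan_neg]
      exact Real.arctan_strictMono.monotone (abs_le.1 habs).1
    · rw [← hat]
      exact Real.arctan_strictMono.monotone (abs_le.1 habs).2
    · rw [Real.cos_arctan, Real.sin_arctan]
      ext
      · simp only; field_simp; ring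
      · simp only; field_simp; linarith

lemma aux_L_pos {θ : ℝ} (h0 : 0 ≤ θ) (h2 : θ ≤ π / 3) :
    √3 * (1 - Real.cos θ) ≤ Real.sin θ := by
  have hpi := Real.pi_pos
  have hc := aux_cos_half (by linarith) h2
  have hs : 0 ≤ Real.sin θ := Real.sin_nonneg_of_nonneg_of_le_pi h0 (by linarith)
  have h3 : √3 ^ 2 = 3 := Real.sq_sqrt (by norm_num)
  apply le_of_sq_le_sq _ hs
  rw [mul_pow, h3]
  nlinarith [Real.sin_sq_add_cos_sq θ, Real.cos_le_one θ]

/-- The linear functional does not drop from `θ₂ ≤ 0` to `0`. -/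
lemma aux_f0 {a b r θ₁ θ₂ : ℝ} (hr : 0 < r) (hb : 0 < b) (h1 : -(π / 3) ≤ θ₁) (h12 : θ₁ < θ₂)
    (h2 : θ₂ ≤ 0)
    (h : r * (√3 * Real.cos θ₁ + Real.sin θ₁) < √3 * a + b ∨
      a * Real.cos θ₁ + b * Real.sin θ₁ < a * Real.cos θ₂ + b * Real.sin θ₂) :
    a * Real.cos θ₂ + b * Real.sin θ₂ ≤ a := by
  have hpi := Real.pi_pos
  have hc1 := aux_cos_half h1 (by linarith)
  have hc2 := aux_cos_half (θ := θ₂) (by linarith) (by linarith)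
  have hs2 : Real.sin θ₂ ≤ 0 := Real.sin_nonpos_of_nonpos_of_neg_pi_le h2 (by linarith)
  have h3 : √3 ^ 2 = 3 := Real.sq_sqrt (by norm_num)
  have h3' : 0 < √3 := by positivity
  have hc2' := Real.cos_le_one θ₂
  rcases le_or_gt 0 a with ha | ha
  · nlinarith
  rcases h with h | h
  · have hL : 0 ≤ √3 * Real.cos θ₁ + Real.sin θ₁ := by
      have : |Real.sin θ₁| ≤ √3 * Real.cos θ₁ := by
        apply abs_le_of_sq_le_sq _ (by positivity)
        rw [mul_pow, h3]; nlinarith [Real.sin_sq_add_cos_sq θ₁]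
      linarith [(abs_le.1 this).1]
    have hab : 0 < √3 * a + b := lt_of_le_of_lt (by positivity) h
    have hp := aux_L_pos (θ := -θ₂) (by linarith) (by linarith)
    rw [Real.cos_neg, Real.sin_neg] at hp
    have e1 : 0 ≤ (√3 * a + b) * (-Real.sin θ₂) := mul_nonneg hab.le (by linarith)
    have e2 : 0 ≤ (-a) * (√3 * (-Real.sin θ₂) - (1 - Real.cos θ₂)) := by
      apply mul_nonneg (by linarith)
      nlinarith
    nlinarith
  · by_contra! hcon
    have hB : 0 < Real.sin (θ₂ - θ₁) := Real.sin_pos_of_pos_of_lt_pi (by linarith) (by linarith)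
    have hC : 0 < -Real.sin θ₁ := by
      rw [← Real.sin_neg]; exact Real.sin_pos_of_pos_of_lt_pi (by linarith) (by linarith)
    rw [Real.sin_sub] at hB
    have hc1' := Real.cos_le_one θ₁
    set f1 := a * Real.cos θ₁ + b * Real.sin θ₁ with hf1
    set f2 := a * Real.cos θ₂ + b * Real.sin θ₂ with hf2
    have hf2n : f2 ≤ 0 := by rw [hf2]; nlinarith
    have hid : (-Real.sin θ₁) * f2 = (-Real.sin θ₂) * f1 +
        (Real.sin θ₂ * Real.cos θ₁ - Real.cos θ₂ * Real.sin θ₁) * a := by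
      rw [hf1, hf2]; ring
    have hABC : 0 ≤ (-Real.sin θ₂) + (Real.sin θ₂ * Real.cos θ₁ - Real.cos θ₂ * Real.sin θ₁)
        - (-Real.sin θ₁) := by
      have hsub : -Real.sin θ₁ = Real.sin (θ₂ - θ₁) * Real.cos θ₂ -
          Real.cos (θ₂ - θ₁) * Real.sin θ₂ := by
        rw [← Real.sin_neg, ← Real.sin_sub]; congr 1; ring
      have hcc := Real.cos_le_one (θ₂ - θ₁)
      rw [hsub]
      rw [← Real.sin_sub] at hB ⊢
      nlinarith
    have e1 := mul_lt_mul_of_pos_left hcon hB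
    have e2 := mul_le_mul_of_nonneg_left h.le (show 0 ≤ -Real.sin θ₂ by linarith)
    have e3 := mul_nonneg hABC (show 0 ≤ -f2 by linarith)
    linarith

/-- If `A(c,r) \ T(c',r')` is disconnected and the center of the larger
disk lies above `c`, then some point of the right arc with positive angle lies in
`T(c',r')`: the topmost intersection of `A(c,r)` with `∂T(c',r')` is strictly above
the horizontal line through `c`. -/
theorem disconnected_implies_top_intersection_above_center (c c' : ℝ × ℝ) (r r' : ℝ)
    (hr : 0 < r) (hrr' : r < r') (hy : c.2 < c'.2) (hgp : GenPos c c')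
    (θ₁ θ₂ θ₃ : ℝ)
    (h₁ : -(π / 3) ≤ θ₁) (h₁₂ : θ₁ < θ₂) (h₂₃ : θ₂ < θ₃) (h₃ : θ₃ ≤ π / 3)
    (hout₁ : gam c r θ₁ ∉ Sector c' r') (hin₂ : gam c r θ₂ ∈ Sector c' r')
    (hout₃ : gam c r θ₃ ∉ Sector c' r') :
    ∃ θ : ℝ, 0 < θ ∧ θ ≤ π / 3 ∧ gam c r θ ∈ Sector c' r' := by
  rcases lt_or_ge 0 θ₂ with hpos | h2
  · exact ⟨θ₂, hpos, by linarith, hin₂⟩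
  have hpi := Real.pi_gt_three
  obtain ⟨x, y⟩ := c
  obtain ⟨x', y'⟩ := c'
  obtain ⟨hL2, hD2⟩ := aux_mem_fwd hin₂
  simp only [gam] at hL2 hD2 hy
  have hr' : 0 ≤ r' := by linarith
  have h3' : 0 < √3 := by positivity
  obtain ⟨a, rfl⟩ : ∃ a, x' = x + a := ⟨x' - x, by ring⟩
  obtain ⟨b, rfl⟩ : ∃ b, y' = y + b := ⟨y' - y, by ring⟩
  have hb : 0 < b := by linarith
  have sc : ∀ θ, (x + r * Real.cos θ - (x + a)) ^ 2 + (y + r * Real.sin θ - (y + b)) ^ 2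
      = r ^ 2 + a ^ 2 + b ^ 2 - 2 * r * (a * Real.cos θ + b * Real.sin θ) := by
    intro θ
    linear_combination r ^ 2 * Real.sin_sq_add_cos_sq θ
  rw [sc] at hD2
  have hs2 : Real.sin θ₂ ≤ 0 := Real.sin_nonpos_of_nonpos_of_neg_pi_le h2 (by linarith)
  -- membership test below the horizontal line through the second center
  have key : ∀ θ, r * Real.sin θ ≤ b → √3 * a + b ≤ r * (√3 * Real.cos θ + Real.sin θ) →
      a * Real.cos θ₂ + b * Real.sin θ₂ ≤ a * Real.cos θ + b * Real.sin θ →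
      gam (x, y) r θ ∈ Sector (x + a, y + b) r' := by
    intro θ e1 e2 e3
    apply aux_mem_bwd hr'
    · simp only [gam]
      rw [abs_of_nonpos (by linarith)]
      linarith
    · simp only [gam]
      rw [sc]
      have := mul_le_mul_of_nonneg_left e3 (show 0 ≤ 2 * r by linarith)
      linarith
  have hL2' : √3 * a + b ≤ r * (√3 * Real.cos θ₂ + Real.sin θ₂) := by
    have := (abs_le.1 hL2).1
    linarith
  have hf0 : a * Real.cos θ₂ + b * Real.sin θ₂ ≤ a := by
    apply aux_f0 hr hb h₁ h₁₂ h2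
    by_contra! hcon
    apply hout₁
    apply key _ _ hcon.1 hcon.2
    have : Real.sin θ₁ ≤ 0 := Real.sin_nonpos_of_nonpos_of_neg_pi_le (by linarith) (by linarith)
    nlinarith
  have hden : 0 < r + |a| := by positivity
  set θ := min 1 (b / (r + |a|)) with hθ
  have hθ0 : 0 < θ := lt_min one_pos (by positivity)
  have hθ1 : θ ≤ 1 := min_le_left _ _
  have hθb : θ * (r + |a|) ≤ b := (le_div_iff₀ hden).1 (min_le_right _ _)
  have habs := abs_nonneg a
  have hsθ : Real.sin θ ≤ θ := Real.sin_le hθ0.le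
  have hsθ' : θ - θ ^ 3 / 6 < Real.sin θ := Real.sin_gt_sub_cube hθ0
  have hcθ : 1 - θ ^ 2 / 2 ≤ Real.cos θ := Real.one_sub_sq_div_two_le_cos
  have hcθ' := Real.cos_le_one θ
  refine ⟨θ, hθ0, by linarith, key θ ?_ ?_ ?_⟩
  · nlinarith
  · have hp := aux_L_pos hθ0.le (show θ ≤ π / 3 by linarith)
    refine hL2'.trans (mul_le_mul_of_nonneg_left ?_ hr.le)
    have := mul_le_mul_of_nonneg_left (Real.cos_le_one θ₂) h3'.le
    linarith
  · refine hf0.trans ?_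
    have e1 : |a| * θ ≤ b := by nlinarith
    have e2 : a * (1 - Real.cos θ) ≤ |a| * (θ ^ 2 / 2) :=
      mul_le_mul (le_abs_self a) (by linarith) (by linarith) habs
    have e3 : |a| * (θ ^ 2 / 2) ≤ b * (θ / 2) := by nlinarith
    have e4 : θ / 2 ≤ Real.sin θ := by nlinarith [pow_pos hθ0 2]
    have e5 := mul_le_mul_of_nonneg_left e4 hb.le
    linarith
end

section
/- Let 0 < r < r', c, c' ∈ ℝ² with c'.y > c.y and with c, c' in general position. Suppose A(c,r) \ T(c',r') is disconnected, i.e., there exist −π/3 ≤ θ₁ < θ₂ < θ₃ ≤ π/3 with γ_{c,r}(θ₁) ∉ T(c',r'), γ_{c,r}(θ₂) ∈ T(c',r'), and γ_{c,r}(θ₃) ∉ T(c',r'). Let θ* be the maximum of the (nonempty, closed) set {θ ∈ [−π/3, π/3] : γ_{c,r}(θ) ∈ T(c',r')}. Then the point γ_{c,r}(θ*) lies on one of the two straight edges of T(c',r'): there exists ρ ∈ [0, r'] such that γ_{c,r}(θ*) = c' + ρ·(cos(π/3), sin(π/3)) or γ_{c,r}(θ*) = c' + ρ·(cos(π/3),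 −sin(π/3)). -/
open Real

theorem sector_iff (c : ℝ × ℝ) (r x y : ℝ) (hr : 0 < r) :
    (x, y) ∈ Sector c r ↔ (x - c.1) ^ 2 + (y - c.2) ^ 2 ≤ r ^ 2 ∧
      y - c.2 ≤ √3 * (x - c.1) ∧ -(y - c.2) ≤ √3 * (x - c.1) := by
  have h3 : √3 ^ 2 = 3 := Real.sq_sqrt (by norm_num)
  have h3p : 0 < √3 := by positivity
  have hpi := Real.pi_pos
  constructor
  · rintro ⟨ρ, θ, h0, h1, h2, h4, he⟩
    simp only [Prod.mk.injEq] at he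
    obtain ⟨hx, hy⟩ := he
    have e1 : x - c.1 = ρ * cos θ := by linarith
    have e2 : y - c.2 = ρ * sin θ := by linarith
    rw [e1, e2]
    have a1 : 0 ≤ sin (π / 3 - θ) := sin_nonneg_of_nonneg_of_le_pi (by linarith) (by linarith)
    have a2 : 0 ≤ sin (π / 3 + θ) := sin_nonneg_of_nonneg_of_le_pi (by linarith) (by linarith)
    rw [sin_sub, sin_pi_div_three, cos_pi_div_three] at a1
    rw [sin_add, sin_pi_div_three, cos_pi_div_three] at a2
    refine ⟨?_, ?_, ?_⟩
    · have := sin_sq_add_cos_sq θ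
      have : (ρ * cos θ) ^ 2 + (ρ * sin θ) ^ 2 = ρ ^ 2 := by linear_combination ρ ^ 2 * this
      rw [this]; gcongr
    · nlinarith [mul_nonneg h0 a1]
    · nlinarith [mul_nonneg h0 a2]
  · rintro ⟨hd, h1, h2⟩
    set u := x - c.1 with hu
    set v := y - c.2 with hv
    have hu0 : 0 ≤ u := by
      have : 0 ≤ √3 * u := by linarith
      exact nonneg_of_mul_nonneg_right this h3p
    have hxx : x = c.1 + u := by rw [hu]; ring
    have hyy : y = c.2 + v := by rw [hv]; ring
    rcases hu0.eq_or_lt with h0 | h0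
    · rw [← h0] at h1 h2
      have hv0 : v = 0 := by linarith
      refine ⟨0, 0, le_rfl, hr.le, by linarith, by linarith, ?_⟩
      rw [hxx, hyy, ← h0, hv0]; simp
    · have ha : arctan √3 = π / 3 := by
        rw [← tan_pi_div_three]
        exact arctan_tan (by linarith) (by linarith)
      refine ⟨√(u ^ 2 + v ^ 2), arctan (v / u), by positivity, ?_, ?_, ?_, ?_⟩
      · exact Real.sqrt_le_iff.2 ⟨hr.le, hd⟩
      · rw [← ha, ← arctan_neg]
        apply arctan_mono
        rw [le_div_iff₀ h0]; linarith
      · rw [← ha]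
        apply arctan_mono
        rw [div_le_iff₀ h0]; linarith
      · have hs : √(1 + (v / u) ^ 2) = √(u ^ 2 + v ^ 2) / u := by
          have : 1 + (v / u) ^ 2 = (u ^ 2 + v ^ 2) / u ^ 2 := by field_simp
          rw [this, Real.sqrt_div (by positivity), Real.sqrt_sq h0.le]
        have hp : 0 < √(u ^ 2 + v ^ 2) := by positivity
        rw [cos_arctan, sin_arctan, hs, hxx, hyy]
        congr 1 <;> field_simp

/-- midpoint form of a difference of values of `a cos + b sin`. -/
theorem mid_diff (a b s t : ℝ) :
    (a * cos t + b * sin t) - (a * cos s + b * sin s) =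
      2 * sin ((t - s) / 2) * (b * cos ((s + t) / 2) - a * sin ((s + t) / 2)) := by
  have h1 := cos_sub_cos t s
  have h2 := sin_sub_sin t s
  rw [show (t + s) / 2 = (s + t) / 2 by ring] at h1 h2
  linear_combination a * h1 + b * h2

set_option maxHeartbeats 2000000 in
theorem core (a b r r' x s t : ℝ) (hr : 0 < r) (hrr' : r < r') (hb : 0 < b)
    (hx : -(π / 3) ≤ x) (hxs : x < s) (hst : s < t) (ht : t ≤ π / 3)
    (hs : (r * cos s - a) ^ 2 + (r * sin s - b) ^ 2 ≤ r' ^ 2)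
    (htd : r' ^ 2 < (r * cos t - a) ^ 2 + (r * sin t - b) ^ 2)
    (htu : 0 ≤ r * cos t - a) :
    (r * cos x - a) ^ 2 + (r * sin x - b) ^ 2 ≤ r' ^ 2 ∧
      r * sin x - b ≤ √3 * (r * cos x - a) ∧ -(r * sin x - b) ≤ √3 * (r * cos x - a) := by
  have hpi := Real.pi_pos
  have h3 : √3 ^ 2 = 3 := Real.sq_sqrt (by norm_num)
  have h3p : 0 < √3 := by positivity
  have hss := sin_sq_add_cos_sq s
  have hts := sin_sq_add_cos_sq t
  have hxx := sin_sq_add_cos_sq x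
  have disc : ∀ θ, (r * cos θ - a) ^ 2 + (r * sin θ - b) ^ 2 =
      r ^ 2 + a ^ 2 + b ^ 2 - 2 * (r * (a * cos θ + b * sin θ)) := by
    intro θ
    linear_combination r ^ 2 * sin_sq_add_cos_sq θ
  rw [disc] at hs htd
  rw [disc]
  have hrr2 : r ^ 2 < r' ^ 2 := by nlinarith
  set m := (s + t) / 2 with hm
  have hg : (a * cos t + b * sin t) - (a * cos s + b * sin s) < 0 := by
    have : r * ((a * cos t + b * sin t) - (a * cos s + b * sin s)) < 0 := by
      rw [mul_sub]; linarith
    by_contra hc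
    push Not at hc
    have := mul_nonneg hr.le hc
    linarith
  rw [mid_diff] at hg
  have hsp : 0 < sin ((t - s) / 2) := sin_pos_of_pos_of_lt_pi (by linarith) (by linarith)
  have hm' : b * cos m - a * sin m < 0 := by
    by_contra hc
    push Not at hc
    have := mul_nonneg (by linarith : 0 ≤ 2 * sin ((t - s) / 2)) hc
    linarith
  have hcm : 0 < cos m := cos_pos_of_mem_Ioo ⟨by linarith, by linarith⟩
  have hct : 0 < cos t := cos_pos_of_mem_Ioo ⟨by linarith, by linarith⟩
  have hbc : 0 < b * cos m := mul_pos hb hcm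
  rcases lt_or_ge 0 m with hm0 | hm0
  · exfalso
    have hsm : 0 < sin m := sin_pos_of_pos_of_lt_pi hm0 (by linarith)
    have hst' : 0 < sin t := sin_pos_of_pos_of_lt_pi (by linarith) (by linarith)
    have ha : 0 < a := by
      by_contra hc
      push Not at hc
      nlinarith
    have hd : 0 < sin (t - m) := sin_pos_of_pos_of_lt_pi (by linarith) (by linarith)
    rw [sin_sub] at hd
    have hbt : b * cos t < a * sin t := by
      have h5 : b * cos t * cos m < a * sin t * cos m := by
        nlinarith [mul_pos ha hd, mul_lt_mul_of_pos_right hm' hct]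
      exact lt_of_mul_lt_mul_right h5 hcm.le
    have hbr : b < r * sin t := by
      have h5 : b * cos t < r * sin t * cos t := by nlinarith
      exact lt_of_mul_lt_mul_right h5 hct.le
    have q1 := mul_nonneg ha.le htu
    have q2 := mul_pos hb (sub_pos.2 hbr)
    have q3 : 0 < r * (a * cos t) := by positivity
    have q4 : 0 < r * (b * sin t) := by positivity
    linarith
  · have hsm : sin m ≤ 0 := sin_nonpos_of_nonpos_of_neg_pi_le hm0 (by linarith)
    have ha : a < 0 := by
      by_contra hc
      push Not at hc
      nlinarith
    have hba : b < -(√3 * a) := by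
      have hd : 0 ≤ sin (π / 3 + m) := sin_nonneg_of_nonneg_of_le_pi (by linarith) (by linarith)
      rw [sin_add, sin_pi_div_three, cos_pi_div_three] at hd
      have q := mul_nonneg (neg_nonneg.2 ha.le) hd
      have h5 : b * cos m < -(√3 * a) * cos m := by linarith
      exact lt_of_mul_lt_mul_right h5 hcm.le
    have a1 : 0 ≤ sin (π / 3 - x) := sin_nonneg_of_nonneg_of_le_pi (by linarith) (by linarith)
    have a2 : 0 ≤ sin (π / 3 + x) := sin_nonneg_of_nonneg_of_le_pi (by linarith) (by linarith)
    rw [sin_sub, sin_pi_div_three, cos_pi_div_three] at a1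
    rw [sin_add, sin_pi_div_three, cos_pi_div_three] at a2
    refine ⟨?_, ?_, ?_⟩
    · have hmd := mid_diff a b x s
      have hk : b * cos ((x + s) / 2) - a * sin ((x + s) / 2) ≤ 0 := by
        have e1 : sin ((x + s) / 2) ≤ sin m :=
          sin_le_sin_of_le_of_le_pi_div_two (by linarith) (by linarith) (by linarith)
        have e2 : cos ((x + s) / 2) ≤ cos m := by
          rw [← cos_neg, ← cos_neg m]
          exact cos_le_cos_of_nonneg_of_le_pi (by linarith) (by linarith) (by linarith)
        have q1 := mul_le_mul_of_nonneg_left e1 (neg_nonneg.2 ha.le)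
        have q2 := mul_le_mul_of_nonneg_left e2 hb.le
        linarith
      have hq : 0 < sin ((s - x) / 2) := sin_pos_of_pos_of_lt_pi (by linarith) (by linarith)
      have : (a * cos s + b * sin s) - (a * cos x + b * sin x) ≤ 0 := by
        rw [hmd]; exact mul_nonpos_of_nonneg_of_nonpos (by linarith) hk
      have := mul_nonneg hr.le (neg_nonneg.2 this)
      linarith
    · have := mul_nonneg hr.le a1
      have : 0 < -a * √3 := mul_pos (neg_pos.2 ha) h3p
      linarith
    · have := mul_nonneg hr.le a2
      linarith

/-- If `A(c,r) \ T(c',r')` is disconnected and the center of the larger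
disk lies above `c`, then the topmost intersection point `γ_{c,r}(θ*)` of the right
arc with `T(c',r')` lies on one of the two straight edges of `T(c',r')`. -/
theorem top_intersection_on_straight_edge (c c' : ℝ × ℝ) (r r' : ℝ)
    (hr : 0 < r) (hrr' : r < r') (hy : c.2 < c'.2) (hgp : GenPos c c')
    (θ₁ θ₂ θ₃ : ℝ)
    (h₁ : -(π / 3) ≤ θ₁) (h₁₂ : θ₁ < θ₂) (h₂₃ : θ₂ < θ₃) (h₃ : θ₃ ≤ π / 3)
    (hout₁ : gam c r θ₁ ∉ Sector c' r') (hin₂ : gam c r θ₂ ∈ Sector c' r')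
    (hout₃ : gam c r θ₃ ∉ Sector c' r')
    (θstar : ℝ)
    (hmax : IsGreatest {θ : ℝ | θ ∈ Set.Icc (-(π / 3)) (π / 3) ∧
      gam c r θ ∈ Sector c' r'} θstar) :
    ∃ ρ : ℝ, 0 ≤ ρ ∧ ρ ≤ r' ∧
      (gam c r θstar = (c'.1 + ρ * Real.cos (π / 3), c'.2 + ρ * Real.sin (π / 3)) ∨
       gam c r θstar = (c'.1 + ρ * Real.cos (π / 3), c'.2 - ρ * Real.sin (π / 3))) := by
  have hpi := Real.pi_pos
  have h3 : √3 ^ 2 = 3 := Real.sq_sqrt (by norm_num)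
  have h3p : 0 < √3 := by positivity
  have hr' : 0 < r' := hr.trans hrr'
  have key : ∀ θ, gam c r θ ∈ Sector c' r' ↔
      (r * cos θ - (c'.1 - c.1)) ^ 2 + (r * sin θ - (c'.2 - c.2)) ^ 2 ≤ r' ^ 2 ∧
      r * sin θ - (c'.2 - c.2) ≤ √3 * (r * cos θ - (c'.1 - c.1)) ∧
      -(r * sin θ - (c'.2 - c.2)) ≤ √3 * (r * cos θ - (c'.1 - c.1)) := by
    intro θ
    unfold gam
    rw [sector_iff _ _ _ _ hr',
      show c.1 + r * cos θ - c'.1 = r * cos θ - (c'.1 - c.1) by ring,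
      show c.2 + r * sin θ - c'.2 = r * sin θ - (c'.2 - c.2) by ring]
  obtain ⟨⟨⟨hs1, hs2⟩, hsin⟩, hub⟩ := hmax
  have hle : θ₂ ≤ θstar := hub ⟨⟨by linarith, by linarith⟩, hin₂⟩
  have hK := (key θstar).1 hsin
  rw [key] at hout₁ hin₂ hout₃
  obtain ⟨a, ha⟩ : ∃ a, a = c'.1 - c.1 := ⟨_, rfl⟩
  obtain ⟨b, hb⟩ : ∃ b, b = c'.2 - c.2 := ⟨_, rfl⟩
  have hb0 : 0 < b := by linarith
  have hrad : ∀ w : ℝ, 0 ≤ w → w ^ 2 + (√3 * w) ^ 2 ≤ r' ^ 2 → 2 * w ≤ r' := by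
    intro w _ h
    exact abs_le_of_sq_le_sq' (by nlinarith) hr'.le |>.2
  simp only [← ha, ← hb] at key hout₁ hin₂ hout₃ hK
  obtain ⟨hd, hup, hlo⟩ := hK
  have hu0 : 0 ≤ r * cos θstar - a := by
    have : 0 ≤ √3 * (r * cos θstar - a) := by linarith
    exact nonneg_of_mul_nonneg_right this h3p
  rcases hup.eq_or_lt with hupe | hup
  · refine ⟨2 * (r * cos θstar - a), by linarith, ?_, Or.inl ?_⟩
    · rw [hupe] at hd
      exact hrad _ hu0 hd
    · rw [sin_pi_div_three, cos_pi_div_three]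
      unfold gam
      ext <;> simp only <;> linarith
  rcases hlo.eq_or_lt with hloe | hlo
  · refine ⟨2 * (r * cos θstar - a), by linarith, ?_, Or.inr ?_⟩
    · rw [← neg_sq (r * sin θstar - b), hloe] at hd
      exact hrad _ hu0 hd
    · rw [sin_pi_div_three, cos_pi_div_three]
      unfold gam
      ext <;> simp only <;> linarith
  exfalso
  have fin : ∀ s t, θ₁ < s → s < t → t ≤ π / 3 →
      (r * cos s - a) ^ 2 + (r * sin s - b) ^ 2 ≤ r' ^ 2 →
      gam c r t ∉ Sector c' r' →
      r * sin t - b ≤ √3 * (r * cos t - a) → -(r * sin t - b) ≤ √3 * (r * cos t - a) →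
      False := by
    intro s t hs hst ht hsd hto hw1 hw2
    rw [key] at hto
    apply hout₁
    refine core a b r r' θ₁ s t hr hrr' hb0 h₁ hs hst ht hsd ?_ ?_
    · by_contra hc
      exact hto ⟨not_lt.1 hc, hw1, hw2⟩
    · have : 0 ≤ √3 * (r * cos t - a) := by linarith
      exact nonneg_of_mul_nonneg_right this h3p
  rcases hs2.eq_or_lt with he | hlt
  · rw [he, sin_pi_div_three, cos_pi_div_three] at hup hlo
    refine fin θ₂ θ₃ h₁₂ h₂₃ h₃ hin₂.1 (by rw [key]; exact hout₃) ?_ ?_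
    · have a1 : 0 ≤ sin (π / 3 - θ₃) := sin_nonneg_of_nonneg_of_le_pi (by linarith) (by linarith)
      rw [sin_sub, sin_pi_div_three, cos_pi_div_three] at a1
      nlinarith [mul_nonneg hr.le a1]
    · rcases le_total 0 θ₃ with h0 | h0
      · have : sin (π / 3) ≤ sin (π / 3 + θ₃) := by
          rcases le_total (π / 3 + θ₃) (π / 2) with h | h
          · exact sin_le_sin_of_le_of_le_pi_div_two (by linarith) h (by linarith)
          · rw [← sin_pi_sub (π / 3 + θ₃)]
            exact sin_le_sin_of_le_of_le_pi_div_two (by linarith) (by linarith) (by linarith)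
        rw [sin_add, sin_pi_div_three, cos_pi_div_three] at this
        nlinarith [mul_le_mul_of_nonneg_left this hr.le]
      · have : sin (π / 3 + θ₂) ≤ sin (π / 3 + θ₃) :=
          sin_le_sin_of_le_of_le_pi_div_two (by linarith) (by linarith) (by linarith)
        rw [sin_add, sin_add, sin_pi_div_three, cos_pi_div_three] at this
        nlinarith [mul_le_mul_of_nonneg_left this hr.le, hin₂.2.2]
  · have e1 : ∀ᶠ t in nhds θstar, r * sin t - b < √3 * (r * cos t - a) :=
      (ContinuousAt.eventually_lt (by fun_prop) (by fun_prop) hup)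
    have e2 : ∀ᶠ t in nhds θstar, -(r * sin t - b) < √3 * (r * cos t - a) :=
      (ContinuousAt.eventually_lt (by fun_prop) (by fun_prop) hlo)
    have e3 : ∀ᶠ t in nhds θstar, t < π / 3 := eventually_lt_nhds hlt
    obtain ⟨t, ⟨⟨t1, t2⟩, t3⟩, t4⟩ := (((e1.and e2).and e3).filter_mono
      (nhdsWithin_le_nhds (s := Set.Ioi θstar))).and self_mem_nhdsWithin |>.exists
    have t4 : θstar < t := t4
    refine fin θstar t (by linarith) t4 t3.le hd ?_ t1.le t2.le
    intro hc
    have := hub ⟨⟨by linarith, t3.le⟩, hc⟩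
    linarith
end

section
/- Let 0 < r < r' and c, c' ∈ ℝ² with c, c' in general position. Suppose A(c,r) \ T(c',r') is disconnected, i.e., there exist −π/3 ≤ θ₁ < θ₂ < θ₃ ≤ π/3 with γ_{c,r}(θ₁) ∉ T(c',r'), γ_{c,r}(θ₂) ∈ T(c',r'), and γ_{c,r}(θ₃) ∉ T(c',r'). Then both endpoints of the right arc A(c,r) lie outside T(c',r'): γ_{c,r}(π/3) ∉ T(c',r') and γ_{c,r}(−π/3) ∉ T(c',r'). -/
open Real



/-- Inequality description of the sector with apex at the origin. -/
def InS (R x y : ℝ) : Prop :=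
  0 ≤ x * cos (π / 6) + y * sin (π / 6) ∧ 0 ≤ x * cos (π / 6) - y * sin (π / 6) ∧
    x ^ 2 + y ^ 2 ≤ R ^ 2

lemma InS_neg {R x y : ℝ} (h : InS R x y) : InS R x (-y) := by
  obtain ⟨h1, h2, h3⟩ := h
  exact ⟨by linarith, by linarith, by linarith [neg_sq y]⟩

lemma mem_Sector_iff (c p : ℝ × ℝ) (R : ℝ) (hR : 0 < R) :
    p ∈ Sector c R ↔ InS R (p.1 - c.1) (p.2 - c.2) := by
  have hpi := Real.pi_pos
  constructor
  · rintro ⟨ρ, θ, h0, hρ, ha, hb, rfl⟩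
    refine ⟨?_, ?_, ?_⟩
    · have : 0 ≤ cos (θ - π / 6) := cos_nonneg_of_mem_Icc ⟨by linarith, by linarith⟩
      have h := mul_nonneg h0 this
      rw [cos_sub] at h
      simp only
      linarith
    · have : 0 ≤ cos (θ + π / 6) := cos_nonneg_of_mem_Icc ⟨by linarith, by linarith⟩
      have h := mul_nonneg h0 this
      rw [cos_add] at h
      simp only
      linarith
    · have h := sin_sq_add_cos_sq θ
      have : (c.1 + ρ * cos θ - c.1) ^ 2 + (c.2 + ρ * sin θ - c.2) ^ 2 = ρ ^ 2 := by
        linear_combination ρ ^ 2 * h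
      simp only
      rw [this]
      gcongr
  · rintro ⟨h1, h2, h3⟩
    obtain ⟨p1, p2⟩ := p
    obtain ⟨c1, c2⟩ := c
    simp only at h1 h2 h3
    obtain ⟨x, hx⟩ : ∃ x, x = p1 - c1 := ⟨_, rfl⟩
    obtain ⟨y, hy⟩ : ∃ y, y = p2 - c2 := ⟨_, rfl⟩
    rw [← hx, ← hy] at h1 h2 h3
    obtain ⟨z, hz⟩ : ∃ z : ℂ, z = ⟨x, y⟩ := ⟨_, rfl⟩
    have e1 : ‖z‖ * cos z.arg = x := by rw [Complex.norm_mul_cos_arg, hz]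
    have e2 : ‖z‖ * sin z.arg = y := by rw [Complex.norm_mul_sin_arg, hz]
    rcases eq_or_ne z 0 with h0 | h0
    · refine ⟨0, 0, le_rfl, hR.le, by linarith, by linarith, ?_⟩
      rw [h0] at e1 e2
      simp at e1 e2
      ext <;> simp <;> linarith
    have hpos : 0 < ‖z‖ := norm_pos_iff.2 h0
    have hsq := sin_sq_add_cos_sq z.arg
    have a1 := Complex.neg_pi_lt_arg z
    have a2 := Complex.arg_le_pi z
    refine ⟨‖z‖, z.arg, hpos.le, ?_, ?_, ?_, ?_⟩
    · apply le_of_sq_le_sq _ hR.le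
      rw [← e1, ← e2] at h3
      nlinarith
    · by_contra hc
      push Not at hc
      have hn : cos (-(z.arg - π / 6)) < 0 :=
        cos_neg_of_pi_div_two_lt_of_lt (by linarith) (by linarith)
      rw [cos_neg, cos_sub] at hn
      rw [← e1, ← e2] at h1
      nlinarith [mul_neg_of_pos_of_neg hpos hn]
    · by_contra hc
      push Not at hc
      have hn : cos (z.arg + π / 6) < 0 :=
        cos_neg_of_pi_div_two_lt_of_lt (by linarith) (by linarith)
      rw [cos_add] at hn
      rw [← e1, ← e2] at h2
      nlinarith [mul_neg_of_pos_of_neg hpos hn]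
    · rw [e1, e2, hx, hy]
      ext <;> simp

lemma between {x y A B C : ℝ} (hA : 0 < x * cos A + y * sin A) (hB : 0 < x * cos B + y * sin B)
    (hBC : B ≤ C) (hCA : C ≤ A) (hAB : A < B + π) (hlt : B < A) :
    0 ≤ x * cos C + y * sin C := by
  have s0 : 0 < sin (A - B) := sin_pos_of_pos_of_lt_pi (by linarith) (by linarith)
  have s1 : 0 ≤ sin (A - C) := sin_nonneg_of_nonneg_of_le_pi (by linarith) (by linarith)
  have s2 : 0 ≤ sin (C - B) := sin_nonneg_of_nonneg_of_le_pi (by linarith) (by linarith)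
  have key : sin (A - B) * (x * cos C + y * sin C) =
      sin (A - C) * (x * cos B + y * sin B) + sin (C - B) * (x * cos A + y * sin A) := by
    simp only [sin_sub]
    ring
  have : 0 ≤ sin (A - B) * (x * cos C + y * sin C) := by
    rw [key]; positivity
  exact nonneg_of_mul_nonneg_right this s0

/-- Difference of the linear functional along the circle. -/
lemma diff_eq (x y a b : ℝ) : (x * cos b + y * sin b) - (x * cos a + y * sin a) =
    2 * sin ((b - a) / 2) * (x * cos ((a + b) / 2 + π / 2) + y * sin ((a + b) / 2 + π / 2)) := by
  have h1 := cos_sub_cos b a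
  have h2 := sin_sub_sin b a
  rw [cos_add_pi_div_two, sin_add_pi_div_two, add_comm a b]
  linear_combination x * h1 + y * h2

lemma core_s13 {x y r R θ₁ θ₂ θ₃ : ℝ} (hr : 0 < r)
    (h₁ : -(π / 3) ≤ θ₁) (h₁₂ : θ₁ < θ₂) (h₂₃ : θ₂ < θ₃) (h₃ : θ₃ ≤ π / 3)
    (hE : InS R (x + r * cos (π / 3)) (y + r * sin (π / 3)))
    (h2 : InS R (x + r * cos θ₂) (y + r * sin θ₂))
    (h3 : ¬ InS R (x + r * cos θ₃) (y + r * sin θ₃)) :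
    InS R (x + r * cos θ₁) (y + r * sin θ₁) := by
  have hpi := Real.pi_pos
  have h₃' : θ₃ < π / 3 := by
    rcases h₃.lt_or_eq with h | h
    · exact h
    · rw [h] at h3; exact absurd hE h3
  obtain ⟨E1, E2, E3⟩ := hE
  obtain ⟨B1, B2, B3⟩ := h2
  have P : ∀ θ, (x + r * cos θ) * cos (π / 6) + (y + r * sin θ) * sin (π / 6)
      = (x * cos (π / 6) + y * sin (π / 6)) + r * cos (θ - π / 6) := by
    intro θ; rw [cos_sub]; ring
  have Q : ∀ θ, (x + r * cos θ) * cos (π / 6) - (y + r * sin θ) * sin (π / 6)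
      = (x * cos (π / 6) - y * sin (π / 6)) + r * cos (θ + π / 6) := by
    intro θ; rw [cos_add]; ring
  have S : ∀ θ, (x + r * cos θ) ^ 2 + (y + r * sin θ) ^ 2
      = x ^ 2 + y ^ 2 + r ^ 2 + 2 * r * (x * cos θ + y * sin θ) := by
    intro θ; linear_combination r ^ 2 * sin_sq_add_cos_sq θ
  have hq : 0 ≤ x * cos (π / 6) - y * sin (π / 6) := by
    rw [Q, show π / 3 + π / 6 = π / 2 by ring, cos_pi_div_two] at E2
    linarith
  have hQ : ∀ θ, -(π / 3) ≤ θ → θ ≤ π / 3 →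
      0 ≤ (x + r * cos θ) * cos (π / 6) - (y + r * sin θ) * sin (π / 6) := by
    intro θ ha hb
    rw [Q]
    have : 0 ≤ cos (θ + π / 6) := cos_nonneg_of_mem_Icc ⟨by linarith, by linarith⟩
    positivity
  have hP3 : 0 ≤ (x + r * cos θ₃) * cos (π / 6) + (y + r * sin θ₃) * sin (π / 6) := by
    rw [P] at E1 B1 ⊢
    rcases le_total θ₃ (π / 6) with h | h
    · have : cos (θ₂ - π / 6) ≤ cos (θ₃ - π / 6) := by
        rw [← cos_neg (θ₂ - π / 6), ← cos_neg (θ₃ - π / 6)]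
        exact cos_le_cos_of_nonneg_of_le_pi (by linarith) (by linarith) (by linarith)
      nlinarith
    · have : cos (π / 3 - π / 6) ≤ cos (θ₃ - π / 6) :=
        cos_le_cos_of_nonneg_of_le_pi (by linarith) (by linarith) (by linarith)
      nlinarith
  have hS3 : R ^ 2 < (x + r * cos θ₃) ^ 2 + (y + r * sin θ₃) ^ 2 := by
    by_contra hc
    exact h3 ⟨hP3, hQ θ₃ (by linarith) h₃, not_lt.1 hc⟩
  rw [S] at hS3 E3 B3
  have d1 : 0 < (x * cos θ₃ + y * sin θ₃) - (x * cos θ₂ + y * sin θ₂) := by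
    by_contra hc
    push Not at hc
    nlinarith
  have d2 : (x * cos (π / 3) + y * sin (π / 3)) - (x * cos θ₃ + y * sin θ₃) < 0 := by
    by_contra hc
    push Not at hc
    nlinarith
  rw [diff_eq] at d1 d2
  have s1 : 0 < sin ((θ₃ - θ₂) / 2) := sin_pos_of_pos_of_lt_pi (by linarith) (by linarith)
  have s2 : 0 < sin ((π / 3 - θ₃) / 2) := sin_pos_of_pos_of_lt_pi (by linarith) (by linarith)
  have s0 : 0 < sin ((θ₂ - θ₁) / 2) := sin_pos_of_pos_of_lt_pi (by linarith) (by linarith)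
  have A : 0 < x * cos ((θ₂ + θ₃) / 2 + π / 2) + y * sin ((θ₂ + θ₃) / 2 + π / 2) :=
    pos_of_mul_pos_right d1 (by positivity)
  have B : 0 < x * cos ((θ₃ + π / 3) / 2 - π / 2) + y * sin ((θ₃ + π / 3) / 2 - π / 2) := by
    have : x * cos ((θ₃ + π / 3) / 2 + π / 2) + y * sin ((θ₃ + π / 3) / 2 + π / 2) < 0 := by
      by_contra hc
      push Not at hc
      have := mul_nonneg s2.le hc
      linarith
    rw [cos_add_pi_div_two, sin_add_pi_div_two] at this
    rw [cos_sub_pi_div_two, sin_sub_pi_div_two]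
    linarith
  refine ⟨?_, hQ θ₁ h₁ (by linarith), ?_⟩
  · have h := between (C := π / 6) A B (by linarith) (by linarith) (by linarith) (by linarith)
    have : 0 ≤ cos (θ₁ - π / 6) := cos_nonneg_of_mem_Icc ⟨by linarith, by linarith⟩
    rw [P]
    positivity
  · have h := between (C := (θ₁ + θ₂) / 2 + π / 2) A B (by linarith) (by linarith)
      (by linarith) (by linarith)
    have e := diff_eq x y θ₁ θ₂
    have := mul_nonneg s0.le h
    rw [S]
    nlinarith

/-- If `A(c,r) \ T(c',r')` is disconnected, then both endpoints of the
right arc `A(c,r)` lie outside `T(c',r')`. -/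
theorem endpoints_outside_of_disconnected (c c' : ℝ × ℝ) (r r' : ℝ)
    (hr : 0 < r) (hrr' : r < r') (hgp : GenPos c c')
    (θ₁ θ₂ θ₃ : ℝ)
    (h₁ : -(π / 3) ≤ θ₁) (h₁₂ : θ₁ < θ₂) (h₂₃ : θ₂ < θ₃) (h₃ : θ₃ ≤ π / 3)
    (hout₁ : gam c r θ₁ ∉ Sector c' r') (hin₂ : gam c r θ₂ ∈ Sector c' r')
    (hout₃ : gam c r θ₃ ∉ Sector c' r') :
    gam c r (π / 3) ∉ Sector c' r' ∧ gam c r (-(π / 3)) ∉ Sector c' r' := by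
  have hR : 0 < r' := hr.trans hrr'
  rw [mem_Sector_iff _ _ _ hR] at hout₁ hin₂ hout₃
  rw [mem_Sector_iff _ _ _ hR, mem_Sector_iff _ _ _ hR]
  simp only [gam, add_sub_right_comm] at *
  constructor
  · intro hE
    exact hout₁ (core_s13 hr h₁ h₁₂ h₂₃ h₃ hE hin₂ hout₃)
  · intro hE
    have flip : ∀ θ, InS r' (c.1 - c'.1 + r * cos θ) (c.2 - c'.2 + r * sin θ) ↔
        InS r' (c.1 - c'.1 + r * cos (-θ)) (-(c.2 - c'.2) + r * sin (-θ)) := by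
      intro θ
      have e : -(c.2 - c'.2) + r * sin (-θ) = -(c.2 - c'.2 + r * sin θ) := by
        rw [sin_neg]; ring
      rw [e, cos_neg]
      exact ⟨InS_neg, fun h => by simpa using InS_neg h⟩
    rw [flip] at hE hin₂ hout₁ hout₃
    rw [neg_neg] at hE
    exact hout₃ (core_s13 hr (by linarith) (by linarith) (by linarith) (by linarith) hE hin₂ hout₁)
end

section
/- Let 0 < r < r' and c, c' ∈ ℝ² with c, c' in general position. Suppose A(c,r) \ T(c',r') is disconnected, i.e., there exist −π/3 ≤ θ₁ < θ₂ < θ₃ ≤ π/3 with γ_{c,r}(θ₁) ∉ T(c',r'), γ_{c,r}(θ₂) ∈ T(c',r'), and γ_{c,r}(θ₃) ∉ T(c',r'). Then the two straight edges of T(c,r), namely the segments {c + ρ·(cos(π/3), sin(π/3)) : 0 ≤ ρ ≤ r} and {c + ρ·(cos(π/3), −sin(π/3)) : 0 ≤ ρ ≤ r}, are disjoint from the topological interior of T(c',r'). (The only part of the boundary of T(c,r) that can enter T(c',r') is the middle portion of the right arc A(c,r).) -/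
open Real

theorem sector_mem (c' p : ℝ × ℝ) (R : ℝ) (hR : 0 < R)
    (hu : 0 ≤ √3 * (p.1 - c'.1) - (p.2 - c'.2)) (hv : 0 ≤ √3 * (p.1 - c'.1) + (p.2 - c'.2))
    (hn : (p.1 - c'.1) ^ 2 + (p.2 - c'.2) ^ 2 ≤ R ^ 2) : p ∈ Sector c' R := by
  have hs : 0 < √3 := by positivity
  obtain ⟨x, hx⟩ : ∃ x, x = p.1 - c'.1 := ⟨_, rfl⟩
  obtain ⟨y, hy⟩ : ∃ y, y = p.2 - c'.2 := ⟨_, rfl⟩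
  rw [← hx, ← hy] at hu hv hn
  have hx0 : 0 ≤ x := by
    by_contra h
    push Not at h
    nlinarith [mul_neg_of_pos_of_neg hs h]
  have key : ∃ ρ θ : ℝ, 0 ≤ ρ ∧ ρ ≤ R ∧ -(π / 3) ≤ θ ∧ θ ≤ π / 3 ∧
      x = ρ * Real.cos θ ∧ y = ρ * Real.sin θ := by
    rcases hx0.eq_or_lt with h | h
    · refine ⟨0, 0, le_rfl, hR.le, by linarith [pi_pos], by linarith [pi_pos], by simp [← h], ?_⟩
      rw [← h] at hu hv
      linarith
    · have h3 : Real.arctan (√3) = π / 3 := by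
        rw [← Real.tan_pi_div_three]
        exact Real.arctan_tan (by linarith [pi_pos]) (by linarith [pi_pos])
      have hc := Real.cos_arctan_pos (y / x)
      have e1 : x / Real.cos (Real.arctan (y / x)) * Real.cos (Real.arctan (y / x)) = x := by
        field_simp
      have e2 : x / Real.cos (Real.arctan (y / x)) * Real.sin (Real.arctan (y / x)) = y := by
        have ht := Real.tan_arctan (y / x)
        rw [Real.tan_eq_sin_div_cos] at ht
        rw [div_mul_eq_mul_div, mul_div_assoc, ht]
        field_simp
      refine ⟨x / Real.cos (Real.arctan (y / x)), Real.arctan (y / x), by positivity, ?_, ?_, ?_,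
        e1.symm, e2.symm⟩
      · refine (sq_le_sq₀ (by positivity) hR.le).1 ?_
        have := Real.sin_sq_add_cos_sq (Real.arctan (y / x))
        calc (x / Real.cos (Real.arctan (y / x))) ^ 2
            = (x / Real.cos (Real.arctan (y / x)) * Real.cos (Real.arctan (y / x))) ^ 2
              + (x / Real.cos (Real.arctan (y / x)) * Real.sin (Real.arctan (y / x))) ^ 2 := by
              rw [mul_pow, mul_pow, ← mul_add, add_comm, this, mul_one]
          _ ≤ R ^ 2 := by rw [e1, e2]; exact hn
      · rw [← h3, ← Real.arctan_neg]
        apply Real.arctan_mono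
        rw [le_div_iff₀ h]; linarith
      · rw [← h3]
        apply Real.arctan_mono
        rw [div_le_iff₀ h]; linarith
  obtain ⟨ρ, θ, a1, a2, a3, a4, a5, a6⟩ := key
  refine ⟨ρ, θ, a1, a2, a3, a4, ?_⟩
  ext
  · simp only; linarith
  · simp only; linarith

theorem uform (θ : ℝ) : √3 * Real.cos θ - Real.sin θ = 2 * Real.cos (θ + π / 6) := by
  rw [Real.cos_add, Real.cos_pi_div_six, Real.sin_pi_div_six]; ring

theorem vform (θ : ℝ) : √3 * Real.cos θ + Real.sin θ = 2 * Real.cos (-θ + π / 6) := by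
  rw [← uform, Real.cos_neg, Real.sin_neg]; ring

theorem ucos_nonneg (θ : ℝ) (h1 : -(π / 3) ≤ θ) (h2 : θ ≤ π / 3) : 0 ≤ Real.cos (θ + π / 6) :=
  Real.cos_nonneg_of_mem_Icc ⟨by linarith [pi_pos], by linarith⟩

theorem mem_sector (c' p : ℝ × ℝ) (R : ℝ) (h : p ∈ Sector c' R) :
    0 ≤ √3 * (p.1 - c'.1) - (p.2 - c'.2) ∧ 0 ≤ √3 * (p.1 - c'.1) + (p.2 - c'.2) ∧
    (p.1 - c'.1) ^ 2 + (p.2 - c'.2) ^ 2 ≤ R ^ 2 := by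
  obtain ⟨ρ, θ, a1, a2, a3, a4, rfl⟩ := h
  have hu := ucos_nonneg θ a3 a4
  have hv := ucos_nonneg (-θ) (by linarith) (by linarith)
  have e1 := uform θ
  have e2 := vform θ
  simp only [add_sub_cancel_left]
  refine ⟨?_, ?_, ?_⟩
  · have := mul_nonneg a1 hu
    linear_combination 2 * this - ρ * e1
  · have := mul_nonneg a1 hv
    linear_combination 2 * this - ρ * e2
  · have : ρ ^ 2 ≤ R ^ 2 := by gcongr
    linear_combination this + ρ ^ 2 * Real.sin_sq_add_cos_sq θ

theorem edge_cross (k r α β : ℝ) (hr : 0 < r) (h1 : -(π / 3) ≤ α) (h12 : α < β)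
    (h2 : β ≤ π / 3) (ha : k + r * (2 * Real.cos (α + π / 6)) < 0)
    (hb : 0 ≤ k + r * (2 * Real.cos (β + π / 6))) : k + r * √3 < 0 := by
  have hlt : Real.cos (α + π / 6) < Real.cos (β + π / 6) := by
    by_contra h
    push Not at h
    nlinarith [mul_le_mul_of_nonneg_left h hr.le]
  have hneg : α + π / 6 < 0 := by
    by_contra h
    push Not at h
    have := Real.cos_le_cos_of_nonneg_of_le_pi h (by linarith [pi_pos] : β + π / 6 ≤ π)
      (by linarith)
    linarith
  have hc : Real.cos (π / 6) ≤ Real.cos (-(α + π / 6)) :=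
    Real.cos_le_cos_of_nonneg_of_le_pi (by linarith) (by linarith [pi_pos]) (by linarith)
  rw [Real.cos_neg, Real.cos_pi_div_six] at hc
  nlinarith [mul_le_mul_of_nonneg_left hc hr.le]

theorem dist_cross (a b α β : ℝ) (h1 : -(π / 3) ≤ α) (h12 : α < β) (h2 : β ≤ π / 3) :
    ∃ S : ℝ, 0 < S ∧ (a * Real.cos β + b * Real.sin β) - (a * Real.cos α + b * Real.sin α)
      = S * (b - a * Real.tan ((α + β) / 2)) := by
  have hc : 0 < Real.cos ((α + β) / 2) :=
    Real.cos_pos_of_mem_Ioo ⟨by linarith [pi_pos], by linarith [pi_pos]⟩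
  have hs : 0 < Real.sin ((β - α) / 2) :=
    Real.sin_pos_of_pos_of_lt_pi (by linarith) (by linarith [pi_pos])
  refine ⟨2 * Real.sin ((β - α) / 2) * Real.cos ((α + β) / 2), by positivity, ?_⟩
  have e1 := Real.cos_sub_cos β α
  have e2 := Real.sin_sub_sin β α
  rw [add_comm β α] at e1 e2
  rw [Real.tan_eq_sin_div_cos]
  have e3 : Real.cos ((α + β) / 2) * (Real.sin ((α + β) / 2) / Real.cos ((α + β) / 2))
    = Real.sin ((α + β) / 2) := by field_simp
  linear_combination a * e1 + b * e2 + 2 * Real.sin ((β - α) / 2) * a * e3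

/-- If `A(c,r) \ T(c',r')` is disconnected, then the two straight edges
of `T(c,r)` are disjoint from the interior of `T(c',r')`: only the middle portion of
the right arc `A(c,r)` can enter `T(c',r')`. -/
theorem straight_edges_avoid_interior (c c' : ℝ × ℝ) (r r' : ℝ)
    (hr : 0 < r) (hrr' : r < r') (hgp : GenPos c c')
    (θ₁ θ₂ θ₃ : ℝ)
    (h₁ : -(π / 3) ≤ θ₁) (h₁₂ : θ₁ < θ₂) (h₂₃ : θ₂ < θ₃) (h₃ : θ₃ ≤ π / 3)
    (hout₁ : gam c r θ₁ ∉ Sector c' r') (hin₂ : gam c r θ₂ ∈ Sector c' r')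
    (hout₃ : gam c r θ₃ ∉ Sector c' r') :
    ∀ ρ : ℝ, 0 ≤ ρ → ρ ≤ r →
      ((c.1 + ρ * Real.cos (π / 3), c.2 + ρ * Real.sin (π / 3)) : ℝ × ℝ) ∉
        interior (Sector c' r') ∧
      ((c.1 + ρ * Real.cos (π / 3), c.2 - ρ * Real.sin (π / 3)) : ℝ × ℝ) ∉
        interior (Sector c' r') := by
  have hs : 0 < √3 := by positivity
  have hR : 0 < r' := hr.trans hrr'
  obtain ⟨a, ha⟩ : ∃ a, a = c.1 - c'.1 := ⟨_, rfl⟩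
  obtain ⟨b, hb⟩ : ∃ b, b = c.2 - c'.2 := ⟨_, rfl⟩
  -- it suffices to locate the center `c` relative to the lines spanned by the edges of `T(c',r')`
  have key : (√3 * a - b < 0 ∧ √3 * a + b < 0) ∨ (√3 * a - b) + r * √3 < 0 ∨
      (√3 * a + b) + r * √3 < 0 := by
    by_contra hk
    push Not at hk
    obtain ⟨hk1, hk2, hk3⟩ := hk
    obtain ⟨u2, v2, n2⟩ := mem_sector _ _ _ hin₂
    have pu : ∀ θ, √3 * ((gam c r θ).1 - c'.1) - ((gam c r θ).2 - c'.2)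
        = (√3 * a - b) + r * (2 * Real.cos (θ + π / 6)) := by
      intro θ; rw [← uform, ha, hb]; simp only [gam]; ring
    have pv : ∀ θ, √3 * ((gam c r θ).1 - c'.1) + ((gam c r θ).2 - c'.2)
        = (√3 * a + b) + r * (2 * Real.cos (-θ + π / 6)) := by
      intro θ; rw [← vform, ha, hb]; simp only [gam]; ring
    have pn : ∀ θ, ((gam c r θ).1 - c'.1) ^ 2 + ((gam c r θ).2 - c'.2) ^ 2
        = a ^ 2 + b ^ 2 + r ^ 2 + 2 * r * (a * Real.cos θ + b * Real.sin θ) := by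
      intro θ; rw [ha, hb]; simp only [gam]
      linear_combination r ^ 2 * Real.sin_sq_add_cos_sq θ
    rw [pu] at u2
    rw [pv] at v2
    rw [pn] at n2
    have t12 : Real.tan ((θ₁ + θ₂) / 2) < Real.tan ((θ₂ + θ₃) / 2) :=
      Real.tan_lt_tan_of_lt_of_lt_pi_div_two (by linarith [pi_pos]) (by linarith [pi_pos])
        (by linarith)
    have tl : -√3 < Real.tan ((θ₁ + θ₂) / 2) := by
      rw [← Real.tan_pi_div_three, ← Real.tan_neg]
      exact Real.tan_lt_tan_of_lt_of_lt_pi_div_two (by linarith [pi_pos]) (by linarith [pi_pos])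
        (by linarith)
    have tr : Real.tan ((θ₂ + θ₃) / 2) < √3 := by
      rw [← Real.tan_pi_div_three]
      exact Real.tan_lt_tan_of_lt_of_lt_pi_div_two (by linarith [pi_pos]) (by linarith [pi_pos])
        (by linarith)
    generalize ht : Real.tan ((θ₁ + θ₂) / 2) = t at *
    generalize ht' : Real.tan ((θ₂ + θ₃) / 2) = t' at *
    have c1 : √3 * a + b < 0 ∨ b < a * t := by
      by_contra hcon
      push Not at hcon
      obtain ⟨hv, hd⟩ := hcon
      apply hout₁
      apply sector_mem _ _ _ hR
      · rw [pu]
        by_contra hneg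
        push Not at hneg
        linarith [edge_cross _ r θ₁ θ₂ hr h₁ h₁₂ (by linarith) hneg u2]
      · rw [pv]
        have := mul_nonneg hr.le (ucos_nonneg (-θ₁) (by linarith) (by linarith))
        linarith
      · rw [pn]
        obtain ⟨S, hS, e⟩ := dist_cross a b θ₁ θ₂ h₁ h₁₂ (by linarith)
        rw [ht] at e
        have := mul_nonneg hr.le (mul_nonneg hS.le (sub_nonneg.2 hd))
        rw [← e] at this
        linarith
    have c3 : √3 * a - b < 0 ∨ a * t' < b := by
      by_contra hcon
      push Not at hcon
      obtain ⟨hv, hd⟩ := hcon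
      apply hout₃
      apply sector_mem _ _ _ hR
      · rw [pu]
        have := mul_nonneg hr.le (ucos_nonneg θ₃ (by linarith) (by linarith))
        linarith
      · rw [pv]
        by_contra hneg
        push Not at hneg
        linarith [edge_cross _ r (-θ₃) (-θ₂) hr (by linarith) (by linarith) (by linarith) hneg v2]
      · rw [pn]
        obtain ⟨S, hS, e⟩ := dist_cross a b θ₂ θ₃ (by linarith) h₂₃ (by linarith)
        rw [ht'] at e
        have := mul_nonneg hr.le (mul_nonneg hS.le (sub_nonneg.2 hd))
        have e' : S * (a * t' - b) = -(S * (b - a * t')) := by ring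
        rw [e', ← e] at this
        linarith
    have fin : ¬ (√3 * a - b < 0 ∧ √3 * a + b < 0) := fun h => absurd (hk1 h.1) (not_le.2 h.2)
    apply fin
    rcases c1 with c1 | c1 <;> rcases c3 with c3 | c3
    · exact ⟨c3, c1⟩
    · have : a < 0 := by
        by_contra h
        push Not at h
        nlinarith [mul_nonneg h (by linarith : 0 ≤ t' + √3)]
      exact ⟨by nlinarith [mul_pos_of_neg_of_neg this (by linarith : t' - √3 < 0)], c1⟩
    · have : a < 0 := by
        by_contra h
        push Not at h
        nlinarith [mul_nonneg h (by linarith : 0 ≤ √3 - t)]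
      exact ⟨c3, by nlinarith [mul_neg_of_neg_of_pos this (by linarith : 0 < t + √3)]⟩
    · have : a < 0 := by
        by_contra h
        push Not at h
        nlinarith [mul_nonneg h (by linarith : 0 ≤ t' - t)]
      exact ⟨by nlinarith [mul_pos_of_neg_of_neg this (by linarith : t' - √3 < 0)],
        by nlinarith [mul_neg_of_neg_of_pos this (by linarith : 0 < t + √3)]⟩
  intro ρ h0 hρ
  have hm : ρ * √3 ≤ r * √3 := by gcongr
  have hm0 : 0 ≤ ρ * √3 := by positivity
  constructor
  · intro hmem
    obtain ⟨u, v, -⟩ := mem_sector _ _ _ (interior_subset hmem)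
    simp only [Real.cos_pi_div_three, Real.sin_pi_div_three] at u v
    rcases key with ⟨k1, k2⟩ | k | k <;> rw [ha, hb] at * <;> linarith
  · intro hmem
    obtain ⟨u, v, -⟩ := mem_sector _ _ _ (interior_subset hmem)
    simp only [Real.cos_pi_div_three, Real.sin_pi_div_three] at u v
    rcases key with ⟨k1, k2⟩ | k | k <;> rw [ha, hb] at * <;> linarith
end

section
/- Let (c₁, r₁), …, (c_n, r_n) be finitely many disks with pairwise distinct radii r_i > 0, pairwise distinct center y-coordinates, and every pair of centers in general position. For each i, let Θ_i ⊆ [−π/3, π/3] be the set of θ such that for every j with r_j > r_i, writing S_{i,j} = {φ ∈ [−π/3, π/3] : γ_{c_i,r_i}(φ) ∉ T(c_j,r_j)}: θ ∈ LC(S_{i,j}) if c_j.y > c_i.y, and θ ∈ HC(S_{i,j}) if c_j.y < c_i.y. (The set γ_{c_i,r_i}(Θ_i) is the arc contributed by the i-th disk to the map M_r.) Let q ∈ ℝ² and let k be an index such that q ∈ d(c_k,r_k), ‖q − c_j‖ > r_j for every j with r_j > r_k, and q ∈ T(c_k,r_k). Let I be the unique point of A(c_k,r_k) with I.y = q.y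 (so I.x ≥ q.x), say I = γ_{c_k,r_k}(θ_I). Then θ_I ∈ Θ_k, and for every index i and every θ ∈ Θ_i with (γ_{c_i,r_i}(θ)).y = q.y and (γ_{c_i,r_i}(θ)).x ≥ q.x, one has (γ_{c_i,r_i}(θ)).x ≥ I.x. That is, the first point of ⋃_i γ_{c_i,r_i}(Θ_i) hit by the rightward horizontal ray from q lies on the arc contributed by the largest disk containing q. -/
open Real

/-- The lowest connected component of `X ⊆ [−π/3, π/3]`: those `θ ∈ X` such that for
all `θ₁ < θ₂ ≤ θ` in `[−π/3, π/3]`, `θ₂ ∉ X → θ₁ ∉ X`. -/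
def LC (X : Set ℝ) : Set ℝ :=
  {θ | θ ∈ X ∧ ∀ θ₁ θ₂ : ℝ, θ₁ ∈ Set.Icc (-(π / 3)) (π / 3) →
    θ₂ ∈ Set.Icc (-(π / 3)) (π / 3) → θ₁ < θ₂ → θ₂ ≤ θ → θ₂ ∉ X → θ₁ ∉ X}

/-- The highest connected component of `X ⊆ [−π/3, π/3]`: those `θ ∈ X` such that for
all `θ ≤ θ₂ < θ₁` in `[−π/3, π/3]`, `θ₂ ∉ X → θ₁ ∉ X`. -/
def HC (X : Set ℝ) : Set ℝ :=
  {θ | θ ∈ X ∧ ∀ θ₁ θ₂ : ℝ, θ₁ ∈ Set.Icc (-(π / 3)) (π / 3) →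
    θ₂ ∈ Set.Icc (-(π / 3)) (π / 3) → θ ≤ θ₂ → θ₂ < θ₁ → θ₂ ∉ X → θ₁ ∉ X}

/-- For disks `i, j` of a family, the set
`S_{i,j} = {φ ∈ [−π/3, π/3] : γ_{c_i,r_i}(φ) ∉ T(c_j,r_j)}`. -/
def Sij {n : ℕ} (c : Fin n → ℝ × ℝ) (r : Fin n → ℝ) (i j : Fin n) : Set ℝ :=
  {φ | φ ∈ Set.Icc (-(π / 3)) (π / 3) ∧ gam (c i) (r i) φ ∉ Sector (c j) (r j)}

/-- The set `Θ_i` of angles surviving the trimming rules: `θ ∈ [−π/3, π/3]` such that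
for every larger disk `j`, `θ ∈ LC(S_{i,j})` if `c_j` is above `c_i`, and
`θ ∈ HC(S_{i,j})` if `c_j` is below `c_i`. The set `γ_{c_i,r_i}(Θ_i)` is the arc
contributed by the `i`-th disk to the map `M_r`. -/
def Theta {n : ℕ} (c : Fin n → ℝ × ℝ) (r : Fin n → ℝ) (i : Fin n) : Set ℝ :=
  {θ | θ ∈ Set.Icc (-(π / 3)) (π / 3) ∧ ∀ j : Fin n, r i < r j →
    (((c i).2 < (c j).2 → θ ∈ LC (Sij c r i j)) ∧
     ((c j).2 < (c i).2 → θ ∈ HC (Sij c r i j)))}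

/-- Cartesian description of a sector with apex at the origin. -/
def Wdg (R x y : ℝ) : Prop := x ^ 2 + y ^ 2 ≤ R ^ 2 ∧ |y| ≤ √3 * x

lemma le_of_sq_le_sq' {x y : ℝ} (h : x ^ 2 ≤ y ^ 2) (hy : 0 ≤ y) : x ≤ y :=
  le_of_abs_le (abs_le_of_sq_le_sq h hy)

lemma nonneg_s3 {x y : ℝ} (h : |y| ≤ √3 * x) : 0 ≤ x :=
  nonneg_of_mul_nonneg_right ((abs_nonneg y).trans h) (by positivity)

lemma sin_le_s3 {t : ℝ} (h : t ∈ Set.Icc (-(π / 3)) (π / 3)) :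
    |Real.sin t| ≤ √3 * Real.cos t := by
  obtain ⟨h1, h2⟩ := h
  have hp := Real.pi_pos
  have e1 : 0 ≤ Real.sin (π / 3 - t) :=
    Real.sin_nonneg_of_nonneg_of_le_pi (by linarith) (by linarith)
  have e2 : 0 ≤ Real.sin (π / 3 + t) :=
    Real.sin_nonneg_of_nonneg_of_le_pi (by linarith) (by linarith)
  rw [Real.sin_sub, Real.sin_pi_div_three, Real.cos_pi_div_three] at e1
  rw [Real.sin_add, Real.sin_pi_div_three, Real.cos_pi_div_three] at e2
  rw [abs_le]
  constructor <;> nlinarith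

lemma cos_pos_s3 {t : ℝ} (h : t ∈ Set.Icc (-(π / 3)) (π / 3)) : 0 < Real.cos t := by
  obtain ⟨h1, h2⟩ := h
  have hp := Real.pi_pos
  exact Real.cos_pos_of_mem_Ioo ⟨by linarith, by linarith⟩

lemma mem_sector_iff {c : ℝ × ℝ} {r : ℝ} (hr : 0 < r) (p : ℝ × ℝ) :
    p ∈ Sector c r ↔ Wdg r (p.1 - c.1) (p.2 - c.2) := by
  constructor
  · rintro ⟨ρ, θ, h0, h1, h2, h3, rfl⟩
    have hs := sin_le_s3 ⟨h2, h3⟩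
    have hsc := Real.sin_sq_add_cos_sq θ
    refine ⟨?_, ?_⟩
    · simp only [add_sub_cancel_left]
      have : (ρ * Real.cos θ) ^ 2 + (ρ * Real.sin θ) ^ 2 = ρ ^ 2 := by
        linear_combination ρ ^ 2 * hsc
      rw [this]
      gcongr
    · simp only [add_sub_cancel_left]
      rw [abs_mul, abs_of_nonneg h0]
      nlinarith
  · rintro ⟨h1, h2⟩
    set x := p.1 - c.1 with hx
    set y := p.2 - c.2 with hy
    have s0 : 0 < √3 := by positivity
    have hx0 : 0 ≤ x := nonneg_s3 h2
    rcases hx0.eq_or_lt with h | h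
    · refine ⟨0, 0, le_rfl, hr.le, by linarith [Real.pi_pos], by linarith [Real.pi_pos], ?_⟩
      rw [← h, mul_zero] at h2
      have hy0 : y = 0 := by
        have := abs_nonneg y
        exact abs_eq_zero.mp (le_antisymm h2 this)
      ext
      · simp; linarith
      · simp; linarith
    · have at3 : Real.arctan (√3) = π / 3 := by
        rw [← Real.tan_pi_div_three, Real.arctan_tan] <;> linarith [Real.pi_pos]
      rw [abs_le] at h2
      set u := y / x with hu
      have yu : y = u * x := by rw [hu]; field_simp
      have u1 : u ≤ √3 := by rw [hu, div_le_iff₀ h]; linarith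
      have u2 : -√3 ≤ u := by rw [hu, le_div_iff₀ h]; linarith
      have sq : 0 < √(1 + u ^ 2) := by positivity
      have ssq : √(1 + u ^ 2) ^ 2 = 1 + u ^ 2 := Real.sq_sqrt (by positivity)
      refine ⟨x * √(1 + u ^ 2), Real.arctan u, by positivity, ?_, ?_, ?_, ?_⟩
      · refine le_of_sq_le_sq' ?_ hr.le
        rw [mul_pow, ssq]
        rw [yu] at h1
        linarith
      · rw [← at3, ← Real.arctan_neg]; exact Real.arctan_mono u2
      · rw [← at3]; exact Real.arctan_mono u1
      · rw [Real.cos_arctan, Real.sin_arctan]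
        ext
        · simp only
          field_simp
          linarith
        · simp only
          field_simp
          linarith

/-- Width estimate. -/
lemma width_est {R w v : ℝ} (hw : 0 ≤ w) (hv : 0 ≤ v) (hvR : 2 * v ≤ R)
    (h : R ^ 2 < w ^ 2 + 3 * v ^ 2) : R < w + v := by
  by_contra hh
  push Not at hh
  nlinarith [mul_nonneg hv (sub_nonneg.2 hvR), mul_nonneg hw (sub_nonneg.2 hh),
    mul_nonneg (sub_nonneg.2 hh) (by linarith : 0 ≤ R - v + w)]

section core
variable {a b r R x y t : ℝ}

lemma core_A (hr : 0 < r) (hR : r < R) (ht : t ∈ Set.Icc (-(π / 3)) (π / 3))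
    (hy : y = b + r * Real.sin t)
    (hq : Wdg r (x - a) (y - b)) (hout : R ^ 2 < x ^ 2 + y ^ 2) :
    ¬ Wdg R (a + r * Real.cos t) y := by
  rintro ⟨h1, h2⟩
  obtain ⟨q1, q2⟩ := hq
  have hc := cos_pos_s3 ht
  have hsc := Real.sin_sq_add_cos_sq t
  have hc1 := Real.cos_le_one t
  have s0 : 0 < √3 := by positivity
  have s3 : √3 ^ 2 = 3 := Real.sq_sqrt (by norm_num)
  have hxa : 0 ≤ x - a := nonneg_s3 q2
  have hX : x ≤ a + r * Real.cos t := by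
    have : x - a ≤ r * Real.cos t := by
      refine le_of_sq_le_sq' ?_ (by positivity)
      have : (y - b) = r * Real.sin t := by linarith
      rw [this] at q1
      have e : (r * Real.cos t) ^ 2 + (r * Real.sin t) ^ 2 = r ^ 2 := by
        linear_combination r ^ 2 * hsc
      linarith
    linarith
  set X := a + r * Real.cos t with hXd
  have hXx : X - x ≤ r := by
    have := mul_le_mul_of_nonneg_left hc1 hr.le
    linarith
  have hx : x < 0 := by
    by_contra hh
    push Not at hh
    nlinarith
  set v := |y| / √3 with hv
  have yv : |y| = √3 * v := by rw [hv]; field_simp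
  have v0 : 0 ≤ v := by positivity
  have y2 : y ^ 2 = 3 * v ^ 2 := by rw [← sq_abs, yv, mul_pow, s3]
  have vX : v ≤ X := by rw [yv] at h2; exact le_of_mul_le_mul_left h2 s0
  have vR : 2 * v ≤ R := le_of_sq_le_sq' (by nlinarith) (by linarith)
  have := width_est (R := R) (w := -x) (by linarith) v0 vR (by linarith [neg_sq x])
  linarith

set_option maxHeartbeats 1000000 in
lemma core_B (hr : 0 < r) (hR : r < R) (ht : t ∈ Set.Icc (-(π / 3)) (π / 3)) (hb : b < 0)
    (hy : y = b + r * Real.sin t)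
    (hq : Wdg r (x - a) (y - b)) (hout : R ^ 2 < x ^ 2 + y ^ 2)
    {t1 t2 : ℝ} (ht1 : t1 ∈ Set.Icc (-(π / 3)) (π / 3)) (ht2 : t2 ∈ Set.Icc (-(π / 3)) (π / 3))
    (h12 : t1 < t2) (h2t : t2 ≤ t)
    (hP : Wdg R (a + r * Real.cos t2) (b + r * Real.sin t2)) :
    Wdg R (a + r * Real.cos t1) (b + r * Real.sin t1) := by
  obtain ⟨q1, q2⟩ := hq
  obtain ⟨P1, P2⟩ := hP
  have hc := cos_pos_s3 ht
  have hsc := Real.sin_sq_add_cos_sq t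
  have hsc1 := Real.sin_sq_add_cos_sq t1
  have hsc2 := Real.sin_sq_add_cos_sq t2
  have hc1 := Real.cos_le_one t
  have hc2 := Real.cos_le_one t2
  have hc20 := cos_pos_s3 ht2
  have hst := sin_le_s3 ht
  have hst1 := sin_le_s3 ht1
  have hpi := Real.pi_pos
  have s0 : 0 < √3 := by positivity
  have s3 : √3 ^ 2 = 3 := Real.sq_sqrt (by norm_num)
  have hs2t : Real.sin t2 ≤ Real.sin t :=
    Real.sin_le_sin_of_le_of_le_pi_div_two (by linarith [ht2.1]) (by linarith [ht.2]) h2t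
  have hxa : 0 ≤ x - a := nonneg_s3 q2
  have hX : x ≤ a + r * Real.cos t := by
    have : x - a ≤ r * Real.cos t := by
      refine le_of_sq_le_sq' ?_ (by positivity)
      have : (y - b) = r * Real.sin t := by linarith
      rw [this] at q1
      have e : (r * Real.cos t) ^ 2 + (r * Real.sin t) ^ 2 = r ^ 2 := by
        linear_combination r ^ 2 * hsc
      linarith
    linarith
  set p1 := a + r * Real.cos t2 with hp1
  set p2 := b + r * Real.sin t2 with hp2
  set X := a + r * Real.cos t with hXd
  have hp2y : p2 ≤ y := by
    have := mul_le_mul_of_nonneg_left hs2t hr.le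
    linarith
  have hpa : p1 - a ≤ r := by
    have := mul_le_mul_of_nonneg_left hc2 hr.le
    linarith
  have p10 : 0 ≤ p1 := nonneg_s3 P2
  rcases lt_or_ge x 0 with hx | hx
  · exfalso
    rcases le_or_gt 0 y with hy0 | hy0
    · set v := y / √3 with hv
      have yv : y = √3 * v := by rw [hv]; field_simp
      have v0 : 0 ≤ v := by positivity
      have y2 : y ^ 2 = 3 * v ^ 2 := by rw [yv, mul_pow, s3]
      have hsin : Real.sin t ≤ √3 / 2 := by
        rw [← Real.sin_pi_div_three]
        exact Real.sin_le_sin_of_le_of_le_pi_div_two (by linarith [ht.1]) (by linarith) ht.2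
      have vR : 2 * v ≤ R := by
        have h1 := mul_le_mul_of_nonneg_left hsin hr.le
        have h2 := mul_le_mul_of_nonneg_right hR.le s0.le
        have : √3 * (2 * v) ≤ √3 * R := by linarith
        exact le_of_mul_le_mul_left this s0
      have := width_est (R := R) (w := -x) (by linarith) v0 vR (by linarith [neg_sq x])
      have : v ≤ x - a := by
        have h := (le_abs_self (y - b)).trans q2
        have : √3 * v ≤ √3 * (x - a) := by linarith
        exact le_of_mul_le_mul_left this s0
      linarith
    · set v := -y / √3 with hv
      have yv : -y = √3 * v := by rw [hv]; field_simp
      have v0 : 0 ≤ v := by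
        rw [hv]; apply div_nonneg <;> linarith
      have y2 : y ^ 2 = 3 * v ^ 2 := by rw [← neg_sq, yv, mul_pow, s3]
      have vp : v ≤ p1 := by
        have h := (neg_abs_le p2)
        have : √3 * v ≤ √3 * p1 := by linarith
        exact le_of_mul_le_mul_left this s0
      have vR : 2 * v ≤ R := by
        refine le_of_sq_le_sq' ?_ (by linarith)
        have h1 := pow_le_pow_left₀ v0 vp 2
        have h2 := pow_le_pow_left₀ (by linarith : 0 ≤ -y) (by linarith : -y ≤ -p2) 2
        rw [neg_sq, neg_sq] at h2
        linarith
      have := width_est (R := R) (w := -x) (by linarith) v0 vR (by linarith [neg_sq x])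
      linarith
  · have hXR : R ^ 2 < X ^ 2 + y ^ 2 := by
      have := pow_le_pow_left₀ hx hX 2
      linarith
    have hIc : (X - a) ^ 2 + (y - b) ^ 2 = r ^ 2 := by
      rw [hXd, hy]; linear_combination r ^ 2 * hsc
    have hPc : (p1 - a) ^ 2 + (p2 - b) ^ 2 = r ^ 2 := by
      rw [hp1, hp2]; linear_combination r ^ 2 * hsc2
    have hL : 0 < (X - p1) * a + (y - p2) * b := by linarith
    have hyb : (y - p2) * b ≤ 0 := mul_nonpos_of_nonneg_of_nonpos (by linarith) hb.le
    have hXa : 0 < (X - p1) * a := by linarith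
    rcases lt_or_ge a 0 with ha | ha
    · exfalso
      have hXp : X < p1 := by
        by_contra hh
        push Not at hh
        have := mul_nonpos_of_nonneg_of_nonpos (sub_nonneg.2 hh) ha.le
        linarith
      have hX0 : 0 ≤ X := hx.trans hX
      rcases le_or_gt 0 y with hy0 | hy0
      · have h1 := pow_le_pow_left₀ hX0 (by linarith : X ≤ X - a) 2
        have h2 := pow_le_pow_left₀ hy0 (by linarith : y ≤ y - b) 2
        have h3 := pow_le_pow_left₀ hr.le hR.le 2
        linarith
      · have h1 := pow_le_pow_left₀ hX0 hXp.le 2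
        have h2 := pow_le_pow_left₀ (by linarith : 0 ≤ -y) (by linarith : -y ≤ -p2) 2
        rw [neg_sq, neg_sq] at h2
        linarith
    · have ha : 0 < a := by
        rcases ha.eq_or_lt with h | h
        · rw [← h] at hXa; simp at hXa
        · exact h
      have hXp : p1 < X := by
        by_contra hh
        push Not at hh
        have := mul_nonpos_of_nonpos_of_nonneg (sub_nonpos.2 hh) ha.le
        linarith
      set m := (t + t2) / 2 with hm
      set d := (t - t2) / 2 with hd
      set m' := (t2 + t1) / 2 with hm'
      set d' := (t2 - t1) / 2 with hd'
      have hmI : m ∈ Set.Icc (-(π / 3)) (π / 3) :=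
        ⟨by linarith [ht.1, ht2.1], by linarith [ht.2, ht2.2]⟩
      have hmI' : m' ∈ Set.Icc (-(π / 3)) (π / 3) :=
        ⟨by linarith [ht1.1, ht2.1], by linarith [ht1.2, ht2.2]⟩
      have sd : 0 ≤ Real.sin d :=
        Real.sin_nonneg_of_nonneg_of_le_pi (by linarith) (by linarith [ht.2, ht2.1])
      have sd' : 0 ≤ Real.sin d' :=
        Real.sin_nonneg_of_nonneg_of_le_pi (by linarith) (by linarith [ht2.2, ht1.1])
      have smm : 0 ≤ Real.sin (m - m') :=
        Real.sin_nonneg_of_nonneg_of_le_pi (by linarith)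
          (by linarith [ht2.2, ht1.1, ht2.1, ht.2])
      rw [Real.sin_sub] at smm
      have cm := cos_pos_s3 hmI
      have cm' := cos_pos_s3 hmI'
      have sm := sin_le_s3 hmI
      have e1 : X - p1 = r * (-2 * Real.sin m * Real.sin d) := by
        rw [← Real.cos_sub_cos]; rw [hXd, hp1]; ring
      have e2 : y - p2 = r * (2 * Real.sin d * Real.cos m) := by
        rw [← Real.sin_sub_sin]; rw [hy, hp2]; ring
      have e1' : Real.cos t2 - Real.cos t1 = -2 * Real.sin m' * Real.sin d' :=
        Real.cos_sub_cos _ _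
      have e2' : Real.sin t2 - Real.sin t1 = 2 * Real.sin d' * Real.cos m' :=
        Real.sin_sub_sin _ _
      have hK0 : 0 < (2 * r * Real.sin d) * (-Real.sin m * a + Real.cos m * b) := by
        rw [e1, e2] at hL; linarith
      have hK : 0 < -Real.sin m * a + Real.cos m * b :=
        pos_of_mul_pos_right hK0 (by positivity)
      have hab : -b ≤ √3 * a := by
        have h1 : -Real.sin m ≤ √3 * Real.cos m := by linarith [neg_abs_le (Real.sin m)]
        have h2 : Real.cos m * (-b) ≤ Real.cos m * (√3 * a) := by
          nlinarith [mul_le_mul_of_nonneg_right h1 ha.le]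
        exact le_of_mul_le_mul_left h2 cm
      have hK' : 0 ≤ -Real.sin m' * a + Real.cos m' * b := by
        have : 0 ≤ Real.cos m * (-Real.sin m' * a + Real.cos m' * b) := by
          have e : Real.cos m * (-Real.sin m' * a + Real.cos m' * b)
            = Real.cos m' * (-Real.sin m * a + Real.cos m * b)
              + a * (Real.sin m * Real.cos m' - Real.cos m * Real.sin m') := by ring
          rw [e]
          positivity
        exact nonneg_of_mul_nonneg_right this cm
      have hN : 0 ≤ (Real.cos t2 - Real.cos t1) * a + (Real.sin t2 - Real.sin t1) * b := by
        rw [e1', e2']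
        have := mul_nonneg sd' hK'
        linarith
      constructor
      · have e : (a + r * Real.cos t1) ^ 2 + (b + r * Real.sin t1) ^ 2 = p1 ^ 2 + p2 ^ 2
          - 2 * r * ((Real.cos t2 - Real.cos t1) * a + (Real.sin t2 - Real.sin t1) * b) := by
          rw [hp1, hp2]
          linear_combination r ^ 2 * hsc1 - r ^ 2 * hsc2
        have := mul_nonneg hr.le hN
        linarith
      · rw [abs_le] at hst1 ⊢
        have h1 := mul_le_mul_of_nonneg_left hst1.1 hr.le
        have h2 := mul_le_mul_of_nonneg_left hst1.2 hr.le
        have h3 := mul_pos s0 ha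
        constructor <;> linarith
end core

lemma Wdg_neg {R x y : ℝ} : Wdg R x (-y) ↔ Wdg R x y := by
  simp [Wdg]

lemma out_sq {p : ℝ × ℝ} {R : ℝ} (hR : 0 < R) (h : R < ptNorm p) : R ^ 2 < p.1 ^ 2 + p.2 ^ 2 := by
  unfold ptNorm at h
  rwa [Real.lt_sqrt hR.le] at h

lemma not_mem_Sij {n : ℕ} {c : Fin n → ℝ × ℝ} {r : Fin n → ℝ} (hr : ∀ i, 0 < r i)
    {i j : Fin n} {φ : ℝ} (hφ : φ ∈ Set.Icc (-(π / 3)) (π / 3)) :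
    φ ∉ Sij c r i j ↔ Wdg (r j) (((c i).1 - (c j).1) + r i * Real.cos φ)
      (((c i).2 - (c j).2) + r i * Real.sin φ) := by
  have : φ ∉ Sij c r i j ↔ gam (c i) (r i) φ ∈ Sector (c j) (r j) := by
    simp only [Sij, Set.mem_setOf_eq, not_and, not_not]
    exact ⟨fun h => h hφ, fun h _ => h⟩
  rw [this, mem_sector_iff (hr j)]
  simp only [gam]
  rw [show (c i).1 + r i * Real.cos φ - (c j).1 = ((c i).1 - (c j).1) + r i * Real.cos φ by ring,
    show (c i).2 + r i * Real.sin φ - (c j).2 = ((c i).2 - (c j).2) + r i * Real.sin φ by ring]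

/-- Lemma 1, the main property of the map `M_r`: if `q` lies in the
right portion of the disk `k`, `q ∈ d(c_k,r_k)`, and `q` lies outside every larger
disk, then the point `I = γ_{c_k,r_k}(θ_I)` where the rightward horizontal ray from
`q` hits `A(c_k,r_k)` belongs to the arc contributed by disk `k`, and it is the first
point of `⋃_i γ_{c_i,r_i}(Θ_i)` hit by that ray. -/
theorem main_map_property {n : ℕ} (c : Fin n → ℝ × ℝ) (r : Fin n → ℝ)
    (hr : ∀ i, 0 < r i)
    (hrinj : Function.Injective r)
    (hyinj : Function.Injective (fun i => (c i).2))
    (hgp : ∀ i j, i ≠ j → GenPos (c i) (c j))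
    (q : ℝ × ℝ) (k : Fin n)
    (hqk : ptNorm (q - c k) ≤ r k)
    (hqlarger : ∀ j, r k < r j → r j < ptNorm (q - c j))
    (hqT : q ∈ Sector (c k) (r k))
    (θI : ℝ) (hθI : θI ∈ Set.Icc (-(π / 3)) (π / 3))
    (hIy : (gam (c k) (r k) θI).2 = q.2) :
    θI ∈ Theta c r k ∧
    ∀ (i : Fin n) (θ : ℝ), θ ∈ Theta c r i →
      (gam (c i) (r i) θ).2 = q.2 → q.1 ≤ (gam (c i) (r i) θ).1 →
      (gam (c k) (r k) θI).1 ≤ (gam (c i) (r i) θ).1 := by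
  have hqW := (mem_sector_iff (hr k) q).1 hqT
  simp only [gam] at hIy ⊢
  have s0 : 0 < √3 := by positivity
  have hqx : 0 ≤ q.1 - (c k).1 := nonneg_s3 hqW.2
  constructor
  · refine ⟨hθI, fun j hj => ?_⟩
    have hout := out_sq (hr j) (hqlarger j hj)
    simp only [Prod.fst_sub, Prod.snd_sub] at hout
    have hy : q.2 - (c j).2 = ((c k).2 - (c j).2) + r k * Real.sin θI := by linarith
    have hW : Wdg (r k) ((q.1 - (c j).1) - ((c k).1 - (c j).1))
        ((q.2 - (c j).2) - ((c k).2 - (c j).2)) := by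
      simpa using hqW
    have hS : θI ∈ Sij c r k j := by
      by_contra hS
      rw [not_mem_Sij hr hθI, ← hy] at hS
      exact core_A (hr k) hj hθI hy hW hout hS
    constructor
    · intro hjk
      refine ⟨hS, fun θ₁ θ₂ h1 h2 h12 h2t hn => ?_⟩
      rw [not_mem_Sij hr h2] at hn
      rw [not_mem_Sij hr h1]
      exact core_B (hr k) hj hθI (by linarith) hy hW hout h1 h2 h12 h2t hn
    · intro hjk
      refine ⟨hS, fun θ₁ θ₂ h1 h2 h2t h12 hn => ?_⟩
      rw [not_mem_Sij hr h2] at hn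
      rw [not_mem_Sij hr h1]
      have key := core_B (t := -θI) (b := -((c k).2 - (c j).2)) (y := -(q.2 - (c j).2))
        (x := q.1 - (c j).1) (a := (c k).1 - (c j).1) (t1 := -θ₁) (t2 := -θ₂)
        (hr k) hj ⟨by linarith [hθI.2], by linarith [hθI.1]⟩ (by linarith)
        (by rw [Real.sin_neg]; linarith)
        (by
          rw [show -(q.2 - (c j).2) - -((c k).2 - (c j).2)
            = -((q.2 - (c j).2) - ((c k).2 - (c j).2)) by ring, Wdg_neg]
          exact hW)
        (by rw [neg_sq]; exact hout)
        ⟨by linarith [h1.2], by linarith [h1.1]⟩ ⟨by linarith [h2.2], by linarith [h2.1]⟩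
        (by linarith) (by linarith)
        (by
          rw [Real.cos_neg, Real.sin_neg, mul_neg, ← neg_add, Wdg_neg]
          exact hn)
      rw [Real.cos_neg, Real.sin_neg, mul_neg, ← neg_add, Wdg_neg] at key
      exact key
  · intro i θ hθ hy hx
    by_contra hlt
    push Not at hlt
    have hcI := Real.cos_le_one θI
    have hrk := hr k
    have hI1 : r k * Real.cos θI ≤ r k := by nlinarith
    rcases lt_trichotomy (r i) (r k) with h | h | h
    · have hne : (c i).2 ≠ (c k).2 := by
        intro he
        have := hyinj he
        rw [this] at h
        exact lt_irrefl _ h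
      have hmem : θ ∈ Sij c r i k := by
        rcases lt_or_gt_of_ne hne with h' | h'
        · exact ((hθ.2 k h).1 h').1
        · exact ((hθ.2 k h).2 h').1
      apply hmem.2
      rw [mem_sector_iff hrk]
      simp only [gam]
      rw [hy]
      refine ⟨?_, ?_⟩
      · have hsc := Real.sin_sq_add_cos_sq θI
        have e : (r k * Real.cos θI) ^ 2 + (q.2 - (c k).2) ^ 2 = r k ^ 2 := by
          rw [← hIy]; linear_combination r k ^ 2 * hsc
        have : ((c i).1 + r i * Real.cos θ - (c k).1) ^ 2 ≤ (r k * Real.cos θI) ^ 2 :=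
          pow_le_pow_left₀ (by linarith) (by linarith) 2
        linarith
      · have := hqW.2
        refine this.trans ?_
        gcongr
    · have := hrinj h
      subst this
      have hs : Real.sin θ = Real.sin θI := by
        have : r i * Real.sin θ = r i * Real.sin θI := by linarith
        exact mul_left_cancel₀ hrk.ne' this
      have hpi := Real.pi_pos
      have : θ = θI := Real.injOn_sin ⟨by linarith [hθ.1.1], by linarith [hθ.1.2]⟩
        ⟨by linarith [hθI.1], by linarith [hθI.2]⟩ hs
      rw [this] at hlt
      exact lt_irrefl _ hlt
    · have hout := out_sq (hr i) (hqlarger i h)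
      simp only [Prod.fst_sub, Prod.snd_sub] at hout
      have hsc := Real.sin_sq_add_cos_sq θ
      have hri := hr i
      have hcos : 1 / 2 ≤ Real.cos θ := by
        rw [← Real.cos_pi_div_three, ← Real.cos_abs θ]
        exact Real.cos_le_cos_of_nonneg_of_le_pi (abs_nonneg _) (by linarith [Real.pi_pos])
          (abs_le.2 hθ.1)
      have hw : r i / 2 ≤ r i * Real.cos θ := by nlinarith
      have e : (r i * Real.cos θ) ^ 2 + (q.2 - (c i).2) ^ 2 = r i ^ 2 := by
        rw [← hy]; linear_combination r i ^ 2 * hsc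
      have h2 : (r i * Real.cos θ) ^ 2 < (q.1 - (c i).1) ^ 2 := by linarith
      have : q.1 - (c i).1 < -(r i * Real.cos θ) := by
        by_contra hh
        push Not at hh
        nlinarith
      linarith
end
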